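/- Let A be a positive definite unimodular lattice of rank 25 containing at least 4 vectors of norm 1 (equivalently, A ≅ L ⊕ I^{25−n} for a unimodular lattice L of dimension n ≤ 23, where I is the rank-1 lattice generated by a norm-1 vector). Let ρ ∈ A ⊗ ℚ be the Weyl vector of the norm-2 root system of A, relative to a ℚ-linear functional nonvanishing on the roots of A. Then the norm B(ρ, ρ) of the Weyl vector is the square of an integer: there exists k ∈ ℤ with B(ρ, ρ) = k². -/

import Mathlib

section Lattice

open Module Submodule

variable {E : Type*} [NormedAddCommGroup E] [InnerProductSpace ℝ E]

/-- A full-rank subgroup of a Euclidean space which equals its own dual lattice. -/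
structure IsUnimodular (L : Submodule ℤ E) : Prop where
  span_eq_top : span ℝ (L : Set E) = ⊤
  mem_iff : ∀ x, x ∈ L ↔ ∀ y ∈ L, ∃ n : ℤ, inner ℝ x y = n

namespace IsUnimodular

variable {L : Submodule ℤ E}

theorem inner_int (hL : IsUnimodular L) {x y : E} (hx : x ∈ L) (hy : y ∈ L) :
    ∃ n : ℤ, inner ℝ x y = n := (hL.mem_iff x).1 hx y hy

theorem one_le_norm (hL : IsUnimodular L) {x : E} (hx : x ∈ L) (h0 : x ≠ 0) : 1 ≤ ‖x‖ := by
  obtain ⟨n, hn⟩ := hL.inner_int hx hx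
  rw [real_inner_self_eq_norm_sq] at hn
  have h1 : (0 : ℝ) < n := by rw [← hn]; positivity
  have h2 : (1 : ℝ) ≤ n := by
    have : 0 < n := by exact_mod_cast h1
    exact_mod_cast this
  rw [← hn] at h2
  exact (one_le_sq_iff₀ (norm_nonneg x)).1 h2

theorem discreteTopology (hL : IsUnimodular L) : DiscreteTopology L := by
  refine DiscreteTopology.of_forall_le_dist one_pos fun x y hxy => ?_
  change 1 ≤ dist x y
  rw [Subtype.dist_eq, dist_eq_norm]
  exact hL.one_le_norm (L.sub_mem x.2 y.2) (sub_ne_zero.2 fun h => hxy (Subtype.ext h))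

theorem isZLattice (hL : IsUnimodular L) [DiscreteTopology L] : IsZLattice ℝ L :=
  ⟨hL.span_eq_top⟩

variable [FiniteDimensional ℝ E]

theorem finite_norm_eq (hL : IsUnimodular L) (r : ℝ) : {x : E | x ∈ L ∧ ‖x‖ ^ 2 = r}.Finite := by
  have := hL.discreteTopology
  have hc : IsClosed (L : Set E) := @AddSubgroup.isClosed_of_discrete _ _ _ _ _
    L.toAddSubgroup (inferInstanceAs (DiscreteTopology L))
  refine (Metric.finite_isBounded_inter_isClosed DiscreteTopology.isDiscrete
    (Metric.isBounded_closedBall (x := (0 : E)) (r := √r)) hc).subset ?_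
  rintro x ⟨hx, hr⟩
  refine ⟨?_, hx⟩
  rw [mem_closedBall_zero_iff, ← hr, Real.sqrt_sq (norm_nonneg x)]

end IsUnimodular

theorem Module.Basis.exists_inner_eq [FiniteDimensional ℝ E] {ι : Type*} (b : Basis ι ℝ E)
    (c : ι → ℝ) : ∃ w : E, ∀ i, inner ℝ w (b i) = c i := by
  refine ⟨(InnerProductSpace.toDual ℝ E).symm (LinearMap.toContinuousLinearMap (b.constr ℝ c)),
    fun i => ?_⟩
  rw [InnerProductSpace.toDual_symm_apply]
  simp

theorem Module.Basis.eq_of_inner_eq {ι : Type*} (b : Basis ι ℝ E) {v w : E}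
    (h : ∀ i, inner ℝ v (b i) = inner ℝ w (b i)) : v = w := by
  refine ext_inner_right ℝ fun x => ?_
  have : innerₗ E v = innerₗ E w := b.ext fun i => by simpa using h i
  simpa using LinearMap.congr_fun this x

open Real in
theorem ZLattice.summable_norm_pow_mul_exp [FiniteDimensional ℝ E] (L : Submodule ℤ E)
    [DiscreteTopology L] [IsZLattice ℝ L] (k : ℕ) {a : ℝ} (ha : 0 < a) (b : ℝ) :
    Summable fun x : L => ‖(x : E)‖ ^ k * exp (-a * ‖(x : E)‖ ^ 2 + b * ‖(x : E)‖) := by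
  set n := finrank ℤ L + 1 with hn
  have hs := ZLattice.summable_norm_pow_inv L n (by omega)
  have hlim : Filter.Tendsto (fun r : ℝ => r ^ (k + n) * exp (-a * r ^ 2 + b * r))
      Filter.atTop (nhds 0) := by
    have h1 := tendsto_pow_mul_exp_neg_atTop_nhds_zero (k + n)
    refine squeeze_zero' ?_ ?_ h1
    · filter_upwards [Filter.eventually_ge_atTop 0] with r hr
      positivity
    · filter_upwards [Filter.eventually_ge_atTop 0, Filter.eventually_ge_atTop ((b + 1) / a)]
        with r hr hr'
      have : b + 1 ≤ a * r := by rw [div_le_iff₀ ha] at hr'; linarith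
      gcongr
      nlinarith
  have hev : ∀ᶠ r : ℝ in Filter.atTop, r ^ (k + n) * exp (-a * r ^ 2 + b * r) < 1 :=
    hlim.eventually (gt_mem_nhds one_pos)
  obtain ⟨R, hR⟩ := Filter.eventually_atTop.1 hev
  refine Summable.of_norm_bounded_eventually hs ?_
  have hc : IsClosed (L : Set E) := @AddSubgroup.isClosed_of_discrete _ _ _ _ _
    L.toAddSubgroup (inferInstanceAs (DiscreteTopology L))
  refine ((Metric.finite_isBounded_inter_isClosed DiscreteTopology.isDiscrete
    (Metric.isBounded_closedBall (x := (0 : E)) (r := max R 0)) hc).preimage_embedding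
    (.subtype _)).subset ?_
  intro x hx
  rw [Set.mem_compl_iff, Set.mem_ofPred_eq, not_le] at hx
  refine ⟨?_, x.2⟩
  simp only [Function.Embedding.subtype_apply, mem_closedBall_zero_iff]
  by_contra! hlt
  have h0 : 0 < ‖(x : E)‖ := (le_max_right _ _).trans_lt hlt
  have h1 := hR _ ((le_max_left _ _).trans hlt.le)
  have h2 : ‖x‖ = ‖(x : E)‖ := rfl
  rw [h2, inv_pow, norm_of_nonneg (by positivity), inv_lt_iff_one_lt_mul₀ (by positivity)] at hx
  rw [pow_add] at h1
  nlinarith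

theorem IsUnimodular.mem_of_basis {L : Submodule ℤ E} (hL : IsUnimodular L) {ι : Type*} [Fintype ι]
    (b : Basis ι ℤ L) {w : E} (h : ∀ i, ∃ n : ℤ, inner ℝ w (b i : E) = n) : w ∈ L := by
  choose n hn using h
  refine (hL.mem_iff w).2 fun y hy => ⟨∑ i, b.repr ⟨y, hy⟩ i * n i, ?_⟩
  have hy' : y = ∑ i, (b.repr ⟨y, hy⟩ i : ℝ) • (b i : E) := by
    have := congrArg (Subtype.val) (b.sum_repr ⟨y, hy⟩)
    simp only [coe_sum, coe_smul_of_tower] at this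
    simpa only [Int.cast_smul_eq_zsmul] using this.symm
  conv_lhs => rw [hy']
  rw [inner_sum]
  push_cast
  exact Finset.sum_congr rfl fun i _ => by rw [inner_smul_right, hn]

end Lattice

section Poisson

open Module Submodule

open MeasureTheory Complex
open scoped Real

variable {E : Type*} [NormedAddCommGroup E] [InnerProductSpace ℝ E] [FiniteDimensional ℝ E]

theorem UnitAddTorus.mFourier_coe_apply {ι : Type*} [Fintype ι] (n : ι → ℤ) (t : ι → ℝ) :
    UnitAddTorus.mFourier n (fun i => (t i : UnitAddCircle)) =
      cexp (2 * π * I * (∑ i, n i * t i : ℝ)) := by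
  simp only [UnitAddTorus.mFourier, ContinuousMap.coe_mk, fourier_coe_apply, ← Complex.exp_sum]
  push_cast
  rw [Finset.mul_sum]
  congr 1
  refine Finset.sum_congr rfl fun i _ => ?_
  simp; ring

theorem UnitAddTorus.exists_continuousMap_lift {ι : Type*} [Fintype ι] {F : (ι → ℝ) → ℂ}
    (hF : Continuous F) (hper : ∀ (t : ι → ℝ) (n : ι → ℤ), F (t + fun i => (n i : ℝ)) = F t) :
    ∃ G : C(UnitAddTorus ι, ℂ), ∀ t : ι → ℝ, G (fun i => (t i : UnitAddCircle)) = F t := by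
  have hq : IsOpenQuotientMap (fun (t : ι → ℝ) i => (t i : UnitAddCircle)) :=
    IsOpenQuotientMap.piMap fun _ => QuotientAddGroup.isOpenQuotientMap_mk
  have hfac : ∀ s t : ι → ℝ, (fun i => (s i : UnitAddCircle)) = (fun i => (t i : UnitAddCircle)) →
      F s = F t := by
    intro s t h
    have h1 : ∀ i, ∃ n : ℤ, (n : ℝ) = s i - t i := fun i => by
      have := congr_fun h i
      rw [← sub_eq_zero, ← AddCircle.coe_sub, AddCircle.coe_eq_zero_iff] at this
      simpa using this
    choose n hn using h1
    rw [← hper t n]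
    congr 1
    ext i
    simp [hn]
  refine ⟨⟨fun x => F (Function.surjInv hq.surjective x), ?_⟩, fun t => ?_⟩
  · rw [hq.isQuotientMap.continuous_iff]
    convert hF using 1
    ext t
    exact hfac _ _ (Function.surjInv_eq hq.surjective _)
  · exact hfac _ _ (Function.surjInv_eq hq.surjective _)

variable [MeasurableSpace E] [BorelSpace E]

theorem ZLattice.setIntegral_tsum_add (L : Submodule ℤ E) [DiscreteTopology L] [IsZLattice ℝ L]
    {s : Set E} (hs : IsAddFundamentalDomain L s (volume : Measure E)) {h : E → ℂ}
    (hh : Integrable h) :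
    ∫ v in s, ∑' x : L, h (v + x) = ∫ v, h v := by
  have : VAddInvariantMeasure L E volume :=
    inferInstanceAs (VAddInvariantMeasure L.toAddSubgroup E volume)
  have hadd : ∀ (g : L) (v : E), g +ᵥ v = v + g := fun g v => add_comm _ _
  rw [hs.integral_eq_tsum'' h hh, integral_tsum]
  · simp only [hadd]
  · intro x
    exact (hh.comp_add_right (x : E)).aestronglyMeasurable.restrict
  · have := hs.lintegral_eq_tsum'' (fun v => ‖h v‖ₑ)
    simp only [hadd] at this
    rw [← this]
    exact hh.hasFiniteIntegral.ne

theorem IsUnimodular.exists_poisson {L : Submodule ℤ E} (hL : IsUnimodular L) :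
    ∃ c : ℝ, 0 < c ∧ ∀ g : E → ℂ, Integrable g → (Continuous fun v => ∑' x : L, g (v + x)) →
      (Summable fun w : L => ∫ v, g v * cexp (-2 * π * I * inner ℝ (w : E) v)) →
      ∀ z : E, ∑' x : L, g (z + x) = c * ∑' w : L,
        (∫ v, g v * cexp (-2 * π * I * inner ℝ (w : E) v)) *
          cexp (2 * π * I * inner ℝ (w : E) z) := by
  have := hL.discreteTopology
  have := hL.isZLattice
  have : Module.Finite ℤ L := ZLattice.module_finite ℝ L
  have : Free ℤ L := ZLattice.module_free ℝ L
  let b := Free.chooseBasis ℤ L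
  let B := b.ofZLatticeBasis ℝ L
  let ψ : (Free.ChooseBasisIndex ℤ L → ℝ) ≃L[ℝ] E :=
    (B.equivFun.symm.trans (LinearEquiv.neg ℝ)).toContinuousLinearEquiv
  have hψ : ∀ t, ψ t = -∑ i, t i • B i := fun t => by simp [ψ, Basis.equivFun_symm_apply]
  have hBL : ∀ i, B i ∈ L := fun i => by simp [B]
  have hfund := ZLattice.isAddFundamentalDomain b (volume : Measure E)
  have hpre : ψ ⁻¹' (ZSpan.fundamentalDomain B) =
      {t | ∀ i, t i ∈ Set.Ioc ((fun _ => -1 : Free.ChooseBasisIndex ℤ L → ℝ) i)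
        ((fun _ => -1 : Free.ChooseBasisIndex ℤ L → ℝ) i + 1)} := by
    ext t
    have : ∀ i, B.repr (ψ t) i = - t i := fun i => by
      rw [hψ, map_neg, Finsupp.neg_apply, B.repr_sum_self]
    simp only [Set.mem_preimage, ZSpan.mem_fundamentalDomain, this]
    refine forall_congr' fun i => ?_
    simp only [Set.mem_Ico, Set.mem_Ioc]
    constructor <;> rintro ⟨h1, h2⟩ <;> constructor <;> linarith
  have hψe : MeasurableEmbedding ψ := ψ.toHomeomorph.measurableEmbedding
  let μ : Measure E := Measure.map ψ volume
  have hμ : μ.IsAddHaarMeasure := ψ.isAddHaarMeasure_map volume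
  set c : NNReal := μ.addHaarScalarFactor volume with hc
  have hμc : μ = c • (volume : Measure E) := Measure.isAddLeftInvariant_eq_smul μ volume
  have hc0 : 0 < c := Measure.addHaarScalarFactor_pos_of_isAddHaarMeasure μ volume
  refine ⟨c, hc0, fun g hg hcont hsum z => ?_⟩
  -- the dual pairing identifies `L` with the character lattice of the torus
  have hpair : ∀ (w : L) (i), ∃ n : ℤ, (n : ℝ) = -inner ℝ (w : E) (B i) := fun w i => by
    obtain ⟨n, hn⟩ := hL.inner_int w.2 (hBL i)
    exact ⟨-n, by simp [hn]⟩
  choose ν hν using hpair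
  have hνbij : Function.Bijective ν := by
    refine ⟨fun w w' h => Subtype.ext (B.eq_of_inner_eq fun i => ?_), fun n => ?_⟩
    · have := hν w i
      rw [h, hν w' i] at this
      linarith
    · obtain ⟨w, hw⟩ := B.exists_inner_eq fun i => -(n i : ℝ)
      have hwL : w ∈ L := hL.mem_of_basis b fun i => ⟨-n i, by simpa [B] using hw i⟩
      refine ⟨⟨w, hwL⟩, funext fun i => ?_⟩
      have := hν ⟨w, hwL⟩ i
      rw [hw, neg_neg] at this
      exact_mod_cast this
  let e := Equiv.ofBijective ν hνbij
  have hinner : ∀ (w : L) (t), inner ℝ (w : E) (ψ t) = ∑ i, ν w i * t i := fun w t => by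
    rw [hψ, inner_neg_right, inner_sum, ← Finset.sum_neg_distrib]
    refine Finset.sum_congr rfl fun i _ => ?_
    rw [inner_smul_right, hν]; ring
  obtain ⟨G, hG⟩ := UnitAddTorus.exists_continuousMap_lift (hcont.comp ψ.continuous) (by
    intro t n
    have hx : ψ (fun i => (n i : ℝ)) ∈ L := by
      rw [hψ]
      refine L.neg_mem (L.sum_mem fun i _ => ?_)
      rw [Int.cast_smul_eq_zsmul]
      exact L.smul_mem _ (hBL i)
    simp only [Function.comp_apply, map_add, add_assoc]
    exact (Equiv.addLeft (⟨_, hx⟩ : L)).tsum_eq fun x : L => g (ψ t + x))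
  have hcoeff : ∀ w : L, UnitAddTorus.mFourierCoeff G (ν w) =
      c * ∫ v, g v * cexp (-2 * π * I * inner ℝ (w : E) v) := by
    intro w
    rw [UnitAddTorus.mFourierCoeff_eq_integral _ _ (fun _ => -1), ← hpre]
    have hint : Integrable fun v => g v * cexp (-2 * π * I * inner ℝ (w : E) v) := by
      refine hg.mul_bdd (c := 1) (by fun_prop) (Filter.Eventually.of_forall fun v => ?_)
      rw [show -2 * π * I * (inner ℝ (w : E) v : ℂ) = ((-2 * π * inner ℝ (w : E) v : ℝ) : ℂ) * I by
        push_cast; ring, norm_exp_ofReal_mul_I]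
    have hperiod : ∀ v, (∑' x : L, g (v + x)) * cexp (-2 * π * I * inner ℝ (w : E) v) =
        ∑' x : L, g (v + x) * cexp (-2 * π * I * inner ℝ (w : E) (v + x)) := by
      intro v
      rw [← tsum_mul_right]
      refine tsum_congr fun x => ?_
      obtain ⟨n, hn⟩ := hL.inner_int w.2 x.2
      rw [inner_add_right, hn]
      congr 1
      rw [Complex.exp_eq_exp_iff_exists_int]
      exact ⟨n, by push_cast; ring⟩
    calc _ = ∫ t in ψ ⁻¹' (ZSpan.fundamentalDomain B),
          (fun v => ∑' x : L, g (v + x) * cexp (-2 * π * I * inner ℝ (w : E) (v + x))) (ψ t) := by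
          refine integral_congr_ae (Filter.Eventually.of_forall fun t => ?_)
          simp only
          rw [hG, ← hperiod, UnitAddTorus.mFourier_neg, UnitAddTorus.mFourier_coe_apply, ← hinner,
            ← Complex.exp_conj, smul_eq_mul, mul_comm]
          simp [Complex.conj_ofReal, map_ofNat]
      _ = ∫ v in ZSpan.fundamentalDomain B,
          ∑' x : L, g (v + x) * cexp (-2 * π * I * inner ℝ (w : E) (v + x)) ∂μ :=
        (hψe.setIntegral_map (μ := volume) (fun v => ∑' x : L,
          g (v + x) * cexp (-2 * π * I * inner ℝ (w : E) (v + x))) (ZSpan.fundamentalDomain B)).symm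
      _ = _ := by
        rw [hμc, Measure.restrict_smul, integral_smul_nnreal_measure,
          ZLattice.setIntegral_tsum_add L hfund hint]
        rfl
  have hS : Summable (UnitAddTorus.mFourierCoeff G) := by
    rw [← e.summable_iff]
    refine (hsum.mul_left (c : ℂ)).congr fun w => ?_
    exact (hcoeff w).symm
  have key := UnitAddTorus.hasSum_mFourier_series_apply_of_summable hS
    (fun i => ((ψ.symm z) i : UnitAddCircle))
  rw [← e.hasSum_iff, hG] at key
  rw [← tsum_mul_left]
  have h2 := key.tsum_eq
  simp only [Function.comp_apply, ContinuousLinearEquiv.apply_symm_apply] at h2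
  rw [← h2]
  refine tsum_congr fun w => ?_
  change _ • (UnitAddTorus.mFourier (ν w)) _ = _
  rw [UnitAddTorus.mFourier_coe_apply, ← hinner, ContinuousLinearEquiv.apply_symm_apply]
  change UnitAddTorus.mFourierCoeff G (ν w) • _ = _
  rw [hcoeff, smul_eq_mul]
  ring

end Poisson

section GaussianPoisson

open Module Submodule MeasureTheory Complex Real

variable {E : Type*} [NormedAddCommGroup E] [InnerProductSpace ℝ E]

theorem norm_cexp_gaussian_le {τ : ℂ} (hτ : 0 ≤ τ.im) {R : ℝ} {x z : E} (hz : ‖z‖ ≤ R) :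
    ‖cexp (π * I * τ * (‖z + x‖ : ℂ) ^ 2)‖ ≤
      rexp (-(π * τ.im) * ‖x‖ ^ 2 + 2 * π * τ.im * R * ‖x‖) := by
  rw [Complex.norm_exp]
  have h1 : (π * I * τ * (‖z + x‖ : ℂ) ^ 2).re = -(π * τ.im) * ‖z + x‖ ^ 2 := by
    have : (π * I * τ * (‖z + x‖ : ℂ) ^ 2) = ((π * ‖z + x‖ ^ 2 : ℝ) : ℂ) * (I * τ) := by
      push_cast; ring
    rw [this, Complex.re_ofReal_mul]
    simp; ring
  rw [h1]
  have h2 : ‖x‖ ^ 2 - 2 * R * ‖x‖ ≤ ‖z + x‖ ^ 2 := by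
    rw [norm_add_sq_real]
    have := neg_le_of_abs_le (abs_real_inner_le_norm z x)
    nlinarith [norm_nonneg x, norm_nonneg z, mul_le_mul_of_nonneg_right hz (norm_nonneg x)]
  have h3 : 0 ≤ π * τ.im := by positivity
  apply Real.exp_le_exp.2
  nlinarith [mul_le_mul_of_nonneg_left h2 h3]

variable [FiniteDimensional ℝ E] {L : Submodule ℤ E}

theorem IsUnimodular.continuous_tsum_gaussian (hL : IsUnimodular L) {τ : ℂ} (hτ : 0 < τ.im) :
    Continuous fun z : E => ∑' x : L, cexp (π * I * τ * (‖z + x‖ : ℂ) ^ 2) := by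
  have := hL.discreteTopology
  have := hL.isZLattice
  have hb : Continuous fun z : E => z := continuous_id
  refine continuous_iff_continuousAt.2 fun z₀ => ?_
  refine ContinuousOn.continuousAt (s := Metric.closedBall 0 (‖z₀‖ + 1)) ?_
    (Metric.closedBall_mem_nhds_of_mem (by simp))
  refine continuousOn_tsum (fun x => by fun_prop)
    (ZLattice.summable_norm_pow_mul_exp L 0 (a := π * τ.im) (by positivity)
      (2 * π * τ.im * (‖z₀‖ + 1))) fun x z hz => ?_
  simpa using norm_cexp_gaussian_le hτ.le (mem_closedBall_zero_iff.1 hz)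

theorem IsUnimodular.tsum_gaussian_add (hL : IsUnimodular L) (hE : finrank ℝ E = 24) {τ : ℂ}
    (hτ : 0 < τ.im) (z : E) :
    ∑' x : L, cexp (π * I * τ * (‖z + x‖ : ℂ) ^ 2) =
      (τ ^ 12)⁻¹ * ∑' x : L, cexp (-(π * I * (‖(x : E)‖ : ℂ) ^ 2 / τ) +
        2 * π * I * inner ℝ (x : E) z) := by
  borelize E
  have := hL.discreteTopology
  have := hL.isZLattice
  have hτ0 : τ ≠ 0 := by rintro rfl; simp at hτ
  obtain ⟨c, hc, hp⟩ := hL.exists_poisson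
  have hre : ∀ {τ : ℂ}, 0 < τ.im → 0 < (-(π * I * τ)).re := by
    intro τ hτ
    simp; positivity
  have hft : ∀ {τ : ℂ}, 0 < τ.im → ∀ w : E,
      ∫ v : E, cexp (π * I * τ * (‖v‖ : ℂ) ^ 2) * cexp (-2 * π * I * inner ℝ w v) =
        (τ ^ 12)⁻¹ * cexp (-(π * I * (‖w‖ : ℂ) ^ 2 / τ)) := by
    intro τ hτ w
    have hτ0 : τ ≠ 0 := by rintro rfl; simp at hτ
    have h := GaussianFourier.integral_cexp_neg_mul_sq_norm_add (hre hτ) (-2 * π * I) w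
    simp only [neg_neg] at h
    simp only [← Complex.exp_add]
    rw [h, hE]
    have hpi : (π : ℂ) ≠ 0 := by exact_mod_cast Real.pi_ne_zero
    congr 1
    · have : ((24 : ℕ) / 2 : ℂ) = ((12 : ℕ) : ℂ) := by norm_num
      rw [this, Complex.cpow_natCast, ← inv_pow]
      have : (π / -(π * I * τ) : ℂ) = I * τ⁻¹ := by
        field_simp
        exact I_sq.symm
      rw [this, mul_pow, show (12 : ℕ) = 4 * 3 by norm_num, pow_mul I, I_pow_four]
      simp
    · congr 1
      field_simp
      ring_nf
  have hsum : ∀ {τ : ℂ}, 0 < τ.im → Summable fun w : L =>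
      (τ ^ 12)⁻¹ * cexp (-(π * I * (‖(w : E)‖ : ℂ) ^ 2 / τ)) := by
    intro τ hτ
    have hτ0 : τ ≠ 0 := by rintro rfl; simp at hτ
    have hτ' : 0 < (-τ⁻¹).im := by
      simp only [Complex.neg_im, Complex.inv_im]
      rw [neg_div, neg_neg]
      exact div_pos hτ (Complex.normSq_pos.2 hτ0)
    refine Summable.mul_left _ (Summable.of_norm_bounded
      (ZLattice.summable_norm_pow_mul_exp L 0 (a := π * (-τ⁻¹).im) (by positivity) 0) fun x => ?_)
    have := norm_cexp_gaussian_le hτ'.le (R := 0) (x := (x : E)) (z := 0) (by simp)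
    simp only [zero_add, mul_zero, zero_mul, pow_zero, one_mul] at this ⊢
    rwa [show -(π * I * (‖(x : E)‖ : ℂ) ^ 2 / τ) = π * I * (-τ⁻¹) * (‖(x : E)‖ : ℂ) ^ 2 by
      field_simp]
  have key : ∀ {τ : ℂ}, 0 < τ.im → ∀ z : E, ∑' x : L, cexp (π * I * τ * (‖z + x‖ : ℂ) ^ 2) =
      c * ∑' w : L, (τ ^ 12)⁻¹ * cexp (-(π * I * (‖(w : E)‖ : ℂ) ^ 2 / τ)) *
        cexp (2 * π * I * inner ℝ (w : E) z) := by
    intro τ hτ z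
    have h := hp (fun v => cexp (π * I * τ * (‖v‖ : ℂ) ^ 2)) ?_ (hL.continuous_tsum_gaussian hτ)
      ?_ z
    · simpa only [hft hτ] using h
    · simpa using GaussianFourier.integrable_cexp_neg_mul_sq_norm_add (hre hτ) 0 (0 : E)
    · simpa only [hft hτ] using hsum hτ
  have hc1 : (c : ℂ) = 1 := by
    have hI : 0 < I.im := by simp
    have h := key hI 0
    have e1 : ∀ x : L, cexp (π * I * I * (‖(0 : E) + x‖ : ℂ) ^ 2) =
      (rexp (-π * ‖(x : E)‖ ^ 2) : ℂ) := by
      intro x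
      push_cast
      congr 1
      rw [zero_add, mul_assoc (π : ℂ), I_mul_I]; ring
    have e2 : ∀ x : L, (I ^ 12)⁻¹ * cexp (-(π * I * (‖(x : E)‖ : ℂ) ^ 2 / I)) *
        cexp (2 * π * I * inner ℝ (x : E) 0) = (rexp (-π * ‖(x : E)‖ ^ 2) : ℂ) := by
      intro x
      have : I ^ 12 = 1 := by rw [show (12 : ℕ) = 4 * 3 by norm_num, pow_mul I, I_pow_four]; simp
      rw [this]
      push_cast
      simp only [inv_one, one_mul, inner_zero_right, ofReal_zero, mul_zero, Complex.exp_zero,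
        mul_one]
      congr 1
      field_simp
    simp only [e1, e2] at h
    rw [← Complex.ofReal_tsum] at h
    have hs : Summable fun x : L => rexp (-π * ‖(x : E)‖ ^ 2) := by
      simpa using ZLattice.summable_norm_pow_mul_exp L 0 Real.pi_pos 0
    have hpos : 0 < ∑' x : L, rexp (-π * ‖(x : E)‖ ^ 2) :=
      hs.tsum_pos (fun _ => (Real.exp_pos _).le) 0 (Real.exp_pos _)
    have h' : ∑' x : L, rexp (-π * ‖(x : E)‖ ^ 2) = c * ∑' x : L, rexp (-π * ‖(x : E)‖ ^ 2) := by
      exact_mod_cast h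
    have : c = 1 := by
      nlinarith [mul_right_cancel₀ hpos.ne' ((one_mul _).trans h')]
    simp [this]
  rw [key hτ, hc1, one_mul, ← tsum_mul_left]
  simp only [Complex.exp_add, mul_assoc]

end GaussianPoisson

section WeightedTheta

open Module Submodule MeasureTheory Complex Real

variable {E : Type*} [NormedAddCommGroup E] [InnerProductSpace ℝ E]

/-- The theta series of `L` with coefficient function `c`, modular variable `τ` and elliptic
variable `z`, the latter scaled by `β`. -/
noncomputable def weightedTheta (L : Submodule ℤ E) (c : E → ℂ) (β τ : ℂ) (z : E) : ℂ :=
  ∑' x : L, c x * cexp (π * I * τ * (‖(x : E)‖ : ℂ) ^ 2 + β * inner ℝ (x : E) z)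

theorem norm_cexp_weighted_le {β τ : ℂ} {R : ℝ} {x z : E} (hz : ‖z‖ ≤ R) :
    ‖cexp (π * I * τ * (‖x‖ : ℂ) ^ 2 + β * inner ℝ x z)‖ ≤
      rexp (-(π * τ.im) * ‖x‖ ^ 2 + ‖β‖ * R * ‖x‖) := by
  rw [Complex.exp_add, Real.exp_add, norm_mul]
  have h1 : ‖cexp (π * I * τ * (‖x‖ : ℂ) ^ 2)‖ = rexp (-(π * τ.im) * ‖x‖ ^ 2) := by
    rw [Complex.norm_exp]
    have : (π * I * τ * (‖x‖ : ℂ) ^ 2) = ((π * ‖x‖ ^ 2 : ℝ) : ℂ) * (I * τ) := by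
      push_cast; ring
    rw [this, Complex.re_ofReal_mul]
    simp; ring
  rw [h1]
  gcongr
  refine (Complex.norm_exp_le_exp_norm _).trans (Real.exp_le_exp.2 ?_)
  rw [norm_mul, Complex.norm_real, mul_assoc]
  gcongr
  exact (norm_inner_le_norm x z).trans (by nlinarith [norm_nonneg x])

variable [FiniteDimensional ℝ E] {L : Submodule ℤ E}

theorem IsUnimodular.hasDerivAt_weightedTheta (hL : IsUnimodular L) {c : E → ℂ} {k : ℕ} {C : ℝ}
    (hc : ∀ x, ‖c x‖ ≤ C * ‖x‖ ^ k) (β : ℂ) {τ : ℂ} (hτ : 0 < τ.im) (u z : E) :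
    HasDerivAt (fun s : ℝ => weightedTheta L c β τ (s • u + z))
      (β * weightedTheta L (fun x => c x * inner ℝ x u) β τ z) 0 := by
  have := hL.discreteTopology
  have := hL.isZLattice
  have hb : ∀ s ∈ Metric.ball (0 : ℝ) 1, ‖s • u + z‖ ≤ ‖u‖ + ‖z‖ := by
    intro s hs
    have hs' : ‖s‖ ≤ 1 := (mem_ball_zero_iff.1 hs).le
    refine (norm_add_le _ _).trans ?_
    rw [norm_smul]
    gcongr
    nlinarith [norm_nonneg u]
  have h0 : (0 : ℝ) ∈ Metric.ball (0 : ℝ) 1 := by simp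
  have hsum := fun k => ZLattice.summable_norm_pow_mul_exp L k (a := π * τ.im) (by positivity)
      (‖β‖ * (‖u‖ + ‖z‖))
  have key := hasDerivAt_tsum_of_isPreconnected
    (g := fun (x : L) (s : ℝ) => c x * cexp (π * I * τ * (‖(x : E)‖ : ℂ) ^ 2 +
      β * inner ℝ (x : E) (s • u + z)))
    (g' := fun (x : L) (s : ℝ) => c x * (cexp (π * I * τ * (‖(x : E)‖ : ℂ) ^ 2 +
      β * inner ℝ (x : E) (s • u + z)) * (β * inner ℝ (x : E) u)))
    ((hsum (k + 1)).mul_left (C * ‖β‖ * ‖u‖)) Metric.isOpen_ball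
    (convex_ball (0 : ℝ) 1).isPreconnected ?_ ?_ h0 ?_ h0
  · unfold weightedTheta
    convert! key using 1
    rw [← tsum_mul_left]
    refine tsum_congr fun x => ?_
    rw [zero_smul, zero_add]
    ring
  · intro x s _
    have h1 : HasDerivAt (fun s : ℝ => inner ℝ (x : E) (s • u + z)) (inner ℝ (x : E) u) s := by
      simp only [inner_add_right, real_inner_smul_right]
      simpa using ((hasDerivAt_id s).mul_const (inner ℝ (x : E) u)).add_const (inner ℝ (x : E) z)
    exact (((h1.ofReal_comp.const_mul β).const_add _).cexp).const_mul _
  · intro x s hs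
    rw [norm_mul, norm_mul, norm_mul, Complex.norm_real]
    have h1 := hc x
    have h2 := norm_cexp_weighted_le (β := β) (τ := τ) (x := (x : E)) (hb s hs)
    have h3 := norm_inner_le_norm (𝕜 := ℝ) (x : E) u
    calc _ ≤ (C * ‖(x : E)‖ ^ k) * (rexp (-(π * τ.im) * ‖(x : E)‖ ^ 2 +
          ‖β‖ * (‖u‖ + ‖z‖) * ‖(x : E)‖) * (‖β‖ * (‖(x : E)‖ * ‖u‖))) := by
          have : 0 ≤ C * ‖(x : E)‖ ^ k := (norm_nonneg _).trans h1
          gcongr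
      _ = _ := by ring
  · refine Summable.of_norm_bounded ((hsum k).mul_left C) fun x => ?_
    rw [norm_mul, ← mul_assoc]
    have : 0 ≤ C * ‖(x : E)‖ ^ k := (norm_nonneg _).trans (hc x)
    exact mul_le_mul (hc x) (norm_cexp_weighted_le (hb 0 h0)) (norm_nonneg _) this

theorem eq_mul_of_hasDerivAt_gaussian_mul {F G : ℝ → ℂ} {F' G' γ K : ℂ}
    (h : ∀ s : ℝ, cexp (γ * s ^ 2) * F s = K * G s) (hF : HasDerivAt F F' 0)
    (hG : HasDerivAt G G' 0) : F' = K * G' := by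
  have h1 : HasDerivAt (fun s : ℝ => cexp (γ * (s : ℂ) ^ 2)) 0 0 := by
    have := ((((hasDerivAt_id (0 : ℝ)).ofReal_comp).pow 2).const_mul γ).cexp
    simpa using this
  have h2 := h1.mul hF
  have h3 := hG.const_mul K
  have h4 : (fun s : ℝ => cexp (γ * (s : ℂ) ^ 2)) * F = fun s => K * G s := funext h
  rw [h4] at h2
  simpa using h2.unique h3

theorem IsUnimodular.weightedTheta_one (hL : IsUnimodular L) (hE : finrank ℝ E = 24) {τ : ℂ}
    (hτ : 0 < τ.im) (z : E) :
    cexp (π * I * τ * (‖z‖ : ℂ) ^ 2) * weightedTheta L (fun _ => 1) (2 * π * I * τ) τ z =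
      (τ ^ 12)⁻¹ * weightedTheta L (fun _ => 1) (2 * π * I) (-τ⁻¹) z := by
  have hτ0 : τ ≠ 0 := by rintro rfl; simp at hτ
  convert! hL.tsum_gaussian_add hE hτ z using 1
  · unfold weightedTheta
    rw [← tsum_mul_left]
    refine tsum_congr fun x => ?_
    rw [one_mul, ← Complex.exp_add]
    congr 1
    have : (‖z + x‖ : ℂ) ^ 2 = ‖z‖ ^ 2 + 2 * inner ℝ (x : E) z + ‖(x : E)‖ ^ 2 := by
      rw [real_inner_comm]
      exact_mod_cast norm_add_sq_real z (x : E)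
    rw [this]; ring
  · unfold weightedTheta
    congr 1
    refine tsum_congr fun x => ?_
    rw [one_mul]
    congr 2
    field_simp

theorem neg_inv_im_pos {τ : ℂ} (hτ : 0 < τ.im) : 0 < (-τ⁻¹).im := by
  have hτ0 : τ ≠ 0 := by rintro rfl; simp at hτ
  simp only [Complex.neg_im, Complex.inv_im]
  rw [neg_div, neg_neg]
  exact div_pos hτ (Complex.normSq_pos.2 hτ0)

theorem IsUnimodular.weightedTheta_inner_mul_inner (hL : IsUnimodular L) (hE : finrank ℝ E = 24)
    {τ : ℂ} (hτ : 0 < τ.im) {u v : E} (huv : inner ℝ u v = 0) :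
    weightedTheta L (fun x => inner ℝ x u * inner ℝ x v) 0 (-τ⁻¹) 0 =
      τ ^ 14 * weightedTheta L (fun x => inner ℝ x u * inner ℝ x v) 0 τ 0 := by
  have hτ0 : τ ≠ 0 := by rintro rfl; simp at hτ
  have hτ' := neg_inv_im_pos hτ
  have hone : ∀ x : E, ‖(fun _ => 1 : E → ℂ) x‖ ≤ 1 * ‖x‖ ^ 0 := by simp
  have hin : ∀ x : E, ‖(fun x => 1 * inner ℝ x u : E → ℂ) x‖ ≤ ‖u‖ * ‖x‖ ^ 1 := by
    intro x
    simp only [one_mul, pow_one]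
    rw [Complex.norm_real, mul_comm]
    exact norm_inner_le_norm x u
  have hnorm : ∀ s t : ℝ, (‖s • u + t • v‖ : ℂ) ^ 2 = s ^ 2 * ‖u‖ ^ 2 + t ^ 2 * ‖v‖ ^ 2 := by
    intro s t
    have h := norm_add_sq_real (s • u) (t • v)
    rw [real_inner_smul_left, real_inner_smul_right, huv, norm_smul, norm_smul, mul_pow, mul_pow,
      Real.norm_eq_abs, Real.norm_eq_abs, sq_abs, sq_abs] at h
    simp only [mul_zero, add_zero] at h
    exact_mod_cast h
  have step1 : ∀ t : ℝ, cexp (π * I * τ * ‖v‖ ^ 2 * t ^ 2) * (2 * π * I * τ *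
      weightedTheta L (fun x => 1 * inner ℝ x u) (2 * π * I * τ) τ (t • v)) =
      (τ ^ 12)⁻¹ * (2 * π * I *
      weightedTheta L (fun x => 1 * inner ℝ x u) (2 * π * I) (-τ⁻¹) (t • v)) := by
    intro t
    refine eq_mul_of_hasDerivAt_gaussian_mul (γ := π * I * τ * ‖u‖ ^ 2) (fun s => ?_)
      ((hL.hasDerivAt_weightedTheta hone _ hτ u (t • v)).const_mul _)
      (hL.hasDerivAt_weightedTheta hone _ hτ' u (t • v))
    rw [← hL.weightedTheta_one hE hτ, hnorm, ← mul_assoc, ← Complex.exp_add]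
    congr 2
    ring
  have step2 := eq_mul_of_hasDerivAt_gaussian_mul
    (F := fun t => 2 * π * I * τ *
      weightedTheta L (fun x => 1 * inner ℝ x u) (2 * π * I * τ) τ (t • v + 0))
    (G := fun t => 2 * π * I *
      weightedTheta L (fun x => 1 * inner ℝ x u) (2 * π * I) (-τ⁻¹) (t • v + 0))
    (by simpa using step1)
    ((hL.hasDerivAt_weightedTheta hin _ hτ v 0).const_mul _)
    ((hL.hasDerivAt_weightedTheta hin _ hτ' v 0).const_mul _)
  have hβ : ∀ β σ : ℂ, weightedTheta L (fun x => 1 * inner ℝ x u * inner ℝ x v) β σ 0 =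
      weightedTheta L (fun x => inner ℝ x u * inner ℝ x v) 0 σ 0 := by
    intro β σ
    simp [weightedTheta]
  rw [hβ, hβ] at step2
  have hpi : (π : ℂ) ≠ 0 := by exact_mod_cast Real.pi_ne_zero
  field_simp at step2
  rw [one_div] at step2
  exact step2.symm

end WeightedTheta

section LevelOne

open UpperHalfPlane ModularForm SlashInvariantForm MatrixGroups Filter Complex
open scoped Topology Manifold

theorem eq_zero_of_isCuspForm_weight_fourteen {F : ℂ → ℂ}
    (hF : DifferentiableOn ℂ F {τ | 0 < τ.im})
    (hS : ∀ τ : ℂ, 0 < τ.im → F (-τ⁻¹) = τ ^ 14 * F τ) (hT : ∀ τ : ℂ, 0 < τ.im → F (τ + 1) = F τ)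
    (hF0 : Tendsto (fun τ : ℍ => F τ) atImInfty (𝓝 0)) {τ : ℂ} (hτ : 0 < τ.im) : F τ = 0 := by
  set f : ℍ → ℂ := fun τ => F τ with hf
  have hS' : f ∣[(14 : ℤ)] ModularGroup.S = f := by
    ext z
    rw [SL_slash_apply, modular_S_smul]
    have := hS z z.im_pos
    rw [neg_inv] at this
    have hz : (z : ℂ) ≠ 0 := z.ne_zero
    have h1 : denom ModularGroup.S z = z := by
      rw [ModularGroup.denom_apply]
      simp [ModularGroup.S]
    simp only [hf, this, h1]
    rw [zpow_neg]
    field_simp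
  have hT' : f ∣[(14 : ℤ)] ModularGroup.T = f := by
    ext z
    rw [SL_slash_apply, modular_T_smul]
    have := hT z z.im_pos
    have h1 : denom ModularGroup.T z = 1 := by
      rw [ModularGroup.denom_apply]
      simp [ModularGroup.T]
    simp [hf, h1, coe_vadd, add_comm (1 : ℂ), this]
  have hslash := slash_action_generators_SL2Z hS' hT'
  let g : CuspForm 𝒮ℒ 14 :=
    { toFun := f
      slash_action_eq' := fun _ ⟨γ, hγ⟩ => hγ ▸ hslash γ
      holo' := by
        rw [UpperHalfPlane.mdifferentiable_iff]
        refine hF.congr fun z hz => ?_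
        simp [hf, ofComplex_apply_of_im_pos hz]
      zero_at_cusps' := fun {c} hc => by
        rw [Subgroup.IsArithmetic.isCusp_iff_isCusp_SL2Z] at hc
        rw [OnePoint.isZeroAt_iff_forall_SL2Z hc]
        intro γ _
        rw [hslash γ]
        exact hF0 }
  have h2 : Subsingleton (ModularForm 𝒮ℒ (14 - 12)) :=
    rank_zero_iff.1 (by exact levelOne_weight_two_rank_zero)
  have hg : g = 0 := CuspForm.discriminantEquiv.injective (Subsingleton.elim _ _)
  exact congrArg (fun g : CuspForm 𝒮ℒ 14 => g ⟨τ, hτ⟩) hg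

end LevelOne

section EvenTheta

open Module Submodule Complex Real Filter
open scoped Topology

variable {E : Type*} [NormedAddCommGroup E] [InnerProductSpace ℝ E]
  {L : Submodule ℤ E}

theorem weightedTheta_add_one (heven : ∀ x ∈ L, ∃ n : ℤ, ‖x‖ ^ 2 = 2 * n) (c : E → ℂ) (τ : ℂ) :
    weightedTheta L c 0 (τ + 1) 0 = weightedTheta L c 0 τ 0 := by
  refine tsum_congr fun x => ?_
  obtain ⟨n, hn⟩ := heven x x.2
  have hn' : (‖(x : E)‖ : ℂ) ^ 2 = 2 * n := by exact_mod_cast hn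
  rw [hn']
  congr 1
  refine Complex.exp_eq_exp_iff_exists_int.2 ⟨n, by ring⟩

variable [FiniteDimensional ℝ E]

theorem IsUnimodular.differentiableOn_weightedTheta (hL : IsUnimodular L) {c : E → ℂ} {k : ℕ}
    {C : ℝ} (hc : ∀ x, ‖c x‖ ≤ C * ‖x‖ ^ k) :
    DifferentiableOn ℂ (fun τ => weightedTheta L c 0 τ 0) {τ | 0 < τ.im} := by
  have := hL.discreteTopology
  have := hL.isZLattice
  intro τ₀ hτ₀
  have hτ₀ : 0 < τ₀.im := hτ₀
  have hU : IsOpen {τ : ℂ | τ₀.im / 2 < τ.im} := isOpen_lt continuous_const continuous_im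
  have hmem : τ₀ ∈ {τ : ℂ | τ₀.im / 2 < τ.im} := half_lt_self hτ₀
  refine DifferentiableAt.differentiableWithinAt (DifferentiableOn.differentiableAt
    (s := {τ : ℂ | τ₀.im / 2 < τ.im}) ?_ (hU.mem_nhds hmem))
  refine differentiableOn_tsum_of_summable_norm ((ZLattice.summable_norm_pow_mul_exp L k
    (a := π * (τ₀.im / 2)) (by positivity) 0).mul_left C) (fun x => by fun_prop) hU
    fun x τ hτ => ?_
  have hτ : τ₀.im / 2 < τ.im := hτ
  have h0 : 0 ≤ C * ‖(x : E)‖ ^ k := (norm_nonneg _).trans (hc x)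
  rw [norm_mul, ← mul_assoc]
  refine mul_le_mul (hc x) ((norm_cexp_weighted_le (R := 0) (by simp)).trans
    (Real.exp_le_exp.2 ?_)) (norm_nonneg _) h0
  simp only [norm_zero, zero_mul, add_zero, neg_mul, neg_le_neg_iff]
  gcongr

theorem IsUnimodular.tendsto_weightedTheta (hL : IsUnimodular L) {c : E → ℂ} {k : ℕ} {C : ℝ}
    (hc : ∀ x, ‖c x‖ ≤ C * ‖x‖ ^ k) (hc0 : c 0 = 0) :
    Tendsto (fun τ : UpperHalfPlane => weightedTheta L c 0 τ 0) UpperHalfPlane.atImInfty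
      (𝓝 0) := by
  have := hL.discreteTopology
  have := hL.isZLattice
  have hs : Summable fun x : L => C * (‖(x : E)‖ ^ k * rexp (-π * ‖(x : E)‖ ^ 2)) := by
    simpa using (ZLattice.summable_norm_pow_mul_exp L k Real.pi_pos 0).mul_left C
  set K := ∑' x : L, C * (‖(x : E)‖ ^ k * rexp (-π * ‖(x : E)‖ ^ 2)) with hK
  have hlim : Tendsto (fun y : ℝ => rexp (-(π * (y - 1))) * K) atTop (𝓝 0) := by
    have h1 : Tendsto (fun y : ℝ => π * (y - 1)) atTop atTop :=
      (tendsto_atTop_add_const_right _ (-1) tendsto_id).const_mul_atTop Real.pi_pos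
    simpa using (Real.tendsto_exp_neg_atTop_nhds_zero.comp h1).mul_const K
  refine squeeze_zero_norm' ?_ (hlim.comp tendsto_comap)
  filter_upwards [tendsto_comap.eventually (eventually_ge_atTop (1 : ℝ))] with τ hτ
  simp only [Function.comp_apply, weightedTheta]
  rw [hK, ← tsum_mul_left]
  refine tsum_of_norm_bounded (hs.mul_left _).hasSum fun x => ?_
  rw [norm_mul]
  by_cases hx : (x : E) = 0
  · have h0 := hc x
    rw [hx, hc0, norm_zero] at h0 ⊢
    rw [zero_mul]
    have := (Real.exp_pos (-π * ‖(0 : E)‖ ^ 2)).le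
    rw [← mul_assoc C]
    positivity
  · have h1 := hL.one_le_norm x.2 hx
    have h0 : 0 ≤ C * ‖(x : E)‖ ^ k := (norm_nonneg _).trans (hc x)
    refine (mul_le_mul (hc x) (norm_cexp_weighted_le (R := 0) (by simp)) (norm_nonneg _) h0).trans
      ?_
    simp only [norm_zero, zero_mul, mul_zero, add_zero]
    rw [mul_left_comm, mul_left_comm (rexp _), ← mul_assoc C, ← Real.exp_add]
    refine mul_le_mul_of_nonneg_left (Real.exp_le_exp.2 ?_) h0
    have h2 : (1 : ℝ) ≤ ‖(x : E)‖ ^ 2 := one_le_pow₀ h1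
    have h3 : (1 : ℝ) ≤ τ.im := hτ
    rw [UpperHalfPlane.coe_im]
    nlinarith [mul_nonneg Real.pi_pos.le (mul_nonneg (sub_nonneg.2 h3) (sub_nonneg.2 h2))]

theorem IsUnimodular.tendsto_exp_mul_weightedTheta (hL : IsUnimodular L)
    (heven : ∀ x ∈ L, ∃ n : ℤ, ‖x‖ ^ 2 = 2 * n) {c : E → ℂ} {k : ℕ} {C : ℝ}
    (hc : ∀ x, ‖c x‖ ≤ C * ‖x‖ ^ k) (hc0 : c 0 = 0) {R : Finset E}
    (hR : ∀ x, x ∈ R ↔ x ∈ L ∧ ‖x‖ ^ 2 = 2) :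
    Tendsto (fun y : ℝ => cexp (2 * π * y) * weightedTheta L c 0 (y * I) 0) atTop
      (𝓝 (∑ x ∈ R, c x)) := by
  have := hL.discreteTopology
  have := hL.isZLattice
  classical
  have hs : Summable fun x : L =>
      rexp (2 * π) * (C * (‖(x : E)‖ ^ k * rexp (-π * ‖(x : E)‖ ^ 2))) := by
    simpa using ((ZLattice.summable_norm_pow_mul_exp L k Real.pi_pos 0).mul_left C).mul_left
      (rexp (2 * π))
  have hsum : ∑ x ∈ R, c x = ∑' x : L, if (x : E) ∈ R then c x else 0 := by
    have h := tsum_subtype (L : Set E) (fun x => if x ∈ R then c x else 0)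
    refine Eq.trans ?_ h.symm
    rw [tsum_eq_sum (s := R) fun x hx => by simp [Set.indicator, hx]]
    refine Finset.sum_congr rfl fun x hx => ?_
    rw [Set.indicator_of_mem ((hR x).1 hx).1, if_pos hx]
  have hterm : ∀ (y : ℝ) (x : E), cexp (2 * π * y) * (c x * cexp (π * I * (y * I) *
      (‖x‖ : ℂ) ^ 2 + 0 * inner ℝ x 0)) = c x * (rexp (-(π * (‖x‖ ^ 2 - 2) * y)) : ℂ) := by
    intro y x
    rw [mul_left_comm, ← Complex.exp_add]
    push_cast
    congr 2
    linear_combination (π * y * (‖x‖ : ℂ) ^ 2) * I_mul_I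
  have hnorm : ∀ x ∈ L, x ≠ 0 → x ∉ R → 2 < ‖x‖ ^ 2 := by
    intro x hx hx0 hxR
    obtain ⟨n, hn⟩ := heven x hx
    have h1 := one_le_pow₀ (hL.one_le_norm hx hx0) (n := 2)
    have h2 : ‖x‖ ^ 2 ≠ 2 := fun h => hxR ((hR x).2 ⟨hx, h⟩)
    rw [hn] at h1 h2 ⊢
    have h3 : (1 : ℤ) ≤ 2 * n := by exact_mod_cast h1
    have h4 : 2 * n ≠ (2 : ℤ) := by exact_mod_cast h2
    have : (2 : ℤ) < 2 * n := by omega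
    exact_mod_cast this
  rw [hsum]
  simp only [weightedTheta, ← tsum_mul_left]
  refine tendsto_tsum_of_dominated_convergence hs (fun x => ?_) ?_
  · simp only [hterm]
    by_cases hx0 : (x : E) = 0
    · simp [hx0, hc0]
    by_cases hxR : (x : E) ∈ R
    · simp [hxR, ((hR x).1 hxR).2]
    · simp only [hxR, if_false]
      have h1 : Tendsto (fun y : ℝ => π * (‖(x : E)‖ ^ 2 - 2) * y) atTop atTop :=
        tendsto_id.const_mul_atTop (mul_pos Real.pi_pos (sub_pos.2 (hnorm x x.2 hx0 hxR)))
      have h2 := (Complex.continuous_ofReal.tendsto _).comp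
        (Real.tendsto_exp_neg_atTop_nhds_zero.comp h1)
      simpa using h2.const_mul (c x)
  · filter_upwards [eventually_ge_atTop (1 : ℝ)] with y hy x
    rw [hterm, norm_mul, Complex.norm_real, Real.norm_of_nonneg (Real.exp_pos _).le]
    by_cases hx0 : (x : E) = 0
    · have h0 := hc x
      rw [hx0, hc0, norm_zero] at h0 ⊢
      rw [zero_mul, ← mul_assoc C]
      positivity
    · have h0 : 0 ≤ C * ‖(x : E)‖ ^ k := (norm_nonneg _).trans (hc x)
      rw [← mul_assoc C, mul_left_comm, ← Real.exp_add]
      refine mul_le_mul (hc x) (Real.exp_le_exp.2 ?_) (Real.exp_pos _).le h0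
      have : 2 ≤ ‖(x : E)‖ ^ 2 := by
        by_cases hxR : (x : E) ∈ R
        · exact ((hR x).1 hxR).2.ge
        · exact (hnorm x x.2 hx0 hxR).le
      nlinarith [mul_nonneg Real.pi_pos.le (mul_nonneg (sub_nonneg.2 hy) (sub_nonneg.2 this))]

theorem IsUnimodular.sum_inner_mul_inner_eq_zero (hL : IsUnimodular L) (hE : finrank ℝ E = 24)
    (heven : ∀ x ∈ L, ∃ n : ℤ, ‖x‖ ^ 2 = 2 * n) {R : Finset E}
    (hR : ∀ x, x ∈ R ↔ x ∈ L ∧ ‖x‖ ^ 2 = 2) {u v : E} (huv : inner ℝ u v = 0) :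
    ∑ x ∈ R, inner ℝ x u * inner ℝ x v = 0 := by
  have hc : ∀ x : E, ‖(inner ℝ x u * inner ℝ x v : ℂ)‖ ≤ ‖u‖ * ‖v‖ * ‖x‖ ^ 2 := by
    intro x
    rw [norm_mul, Complex.norm_real, Complex.norm_real]
    calc _ ≤ (‖x‖ * ‖u‖) * (‖x‖ * ‖v‖) := by
          gcongr <;> exact norm_inner_le_norm _ _
      _ = _ := by ring
  have hc0 : (inner ℝ (0 : E) u * inner ℝ (0 : E) v : ℂ) = 0 := by simp
  have hzero : ∀ τ : ℂ, 0 < τ.im →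
      weightedTheta L (fun x => inner ℝ x u * inner ℝ x v) 0 τ 0 = 0 := fun τ hτ =>
    eq_zero_of_isCuspForm_weight_fourteen (hL.differentiableOn_weightedTheta hc)
      (fun τ hτ => hL.weightedTheta_inner_mul_inner hE hτ huv)
      (fun τ _ => weightedTheta_add_one heven _ τ) (hL.tendsto_weightedTheta hc hc0) hτ
  have h1 := hL.tendsto_exp_mul_weightedTheta heven hc hc0 hR
  have h2 : Tendsto (fun y : ℝ => cexp (2 * π * y) *
      weightedTheta L (fun x => inner ℝ x u * inner ℝ x v) 0 (y * I) 0) atTop (𝓝 0) := by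
    refine tendsto_const_nhds.congr' ?_
    filter_upwards [eventually_gt_atTop (0 : ℝ)] with y hy
    rw [hzero _ (by simpa using hy), mul_zero]
  exact_mod_cast tendsto_nhds_unique h1 h2

end EvenTheta

section Venkov

open Module

variable {E : Type*} [NormedAddCommGroup E] [InnerProductSpace ℝ E]

theorem exists_sum_inner_smul_eq_smul {R : Finset E}
    (hR : ∀ u v : E, inner ℝ u v = 0 → ∑ x ∈ R, inner ℝ x u * inner ℝ x v = 0)
    {e : E} (he : ‖e‖ = 1) : ∃ c : ℝ, ∀ w : E, ∑ x ∈ R, inner ℝ x w • x = c • w := by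
  have hin : ∀ u v : E, inner ℝ (∑ x ∈ R, inner ℝ x u • x) v =
      ∑ x ∈ R, inner ℝ x u * inner ℝ x v := by
    intro u v
    simp only [sum_inner, real_inner_smul_left]
  have hunit : ∀ u : E, ‖u‖ = 1 → ∑ x ∈ R, inner ℝ x u • x =
      (∑ x ∈ R, inner ℝ x u * inner ℝ x u) • u := by
    intro u hu
    refine ext_inner_right ℝ fun v => ?_
    have h1 : inner ℝ u (v - inner ℝ u v • u) = 0 := by
      rw [inner_sub_right, real_inner_smul_right, real_inner_self_eq_norm_sq, hu]; ring
    have h2 := hR _ _ h1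
    rw [← hin, inner_sub_right, real_inner_smul_right, sub_eq_zero] at h2
    rw [h2, real_inner_smul_left, hin, mul_comm]
  refine ⟨∑ x ∈ R, inner ℝ x e * inner ℝ x e, fun w => ?_⟩
  by_cases hw : w = 0
  · simp [hw]
  obtain ⟨u, r, hu1, rfl⟩ : ∃ (u : E) (r : ℝ), ‖u‖ = 1 ∧ w = r • u :=
    ⟨‖w‖⁻¹ • w, ‖w‖, norm_smul_inv_norm (𝕜 := ℝ) hw,
      (smul_inv_smul₀ (norm_ne_zero_iff.2 hw) w).symm⟩
  have h1 : inner ℝ (u + e) (u - e) = 0 := by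
    rw [inner_add_left, inner_sub_right, inner_sub_right, real_inner_self_eq_norm_sq,
      real_inner_self_eq_norm_sq, hu1, he, real_inner_comm]; ring
  have h2 := hR _ _ h1
  have h3 : ∑ x ∈ R, inner ℝ x u * inner ℝ x u = ∑ x ∈ R, inner ℝ x e * inner ℝ x e := by
    rw [← sub_eq_zero, ← Finset.sum_sub_distrib, ← h2]
    refine Finset.sum_congr rfl fun x _ => ?_
    rw [inner_add_right, inner_sub_right]; ring
  rw [smul_comm, ← h3, ← hunit u hu1, Finset.smul_sum]
  refine Finset.sum_congr rfl fun x _ => ?_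
  rw [real_inner_smul_right, mul_smul]

theorem sum_norm_sq_eq_of_sum_inner_smul [FiniteDimensional ℝ E] {R : Finset E} {c : ℝ}
    (h : ∀ w : E, ∑ x ∈ R, inner ℝ x w • x = c • w) :
    ∑ x ∈ R, ‖x‖ ^ 2 = finrank ℝ E * c := by
  have b := stdOrthonormalBasis ℝ E
  have h1 : ∀ i, ∑ x ∈ R, inner ℝ x (b i) ^ 2 = c := by
    intro i
    have := congrArg (fun v => inner ℝ v (b i)) (h (b i))
    simpa only [sum_inner, real_inner_smul_left, real_inner_self_eq_norm_sq, b.norm_eq_one,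
      one_pow, mul_one, ← pow_two] using this
  calc ∑ x ∈ R, ‖x‖ ^ 2 = ∑ x ∈ R, ∑ i, inner ℝ x (b i) ^ 2 := by
        refine Finset.sum_congr rfl fun x _ => ?_
        rw [← b.sum_sq_norm_inner_left x]
        simp
    _ = _ := by
        rw [Finset.sum_comm, Finset.sum_congr rfl fun i _ => h1 i]
        simp

end Venkov

section Characteristic

open Module Complex Real

variable {E : Type*} [NormedAddCommGroup E] [InnerProductSpace ℝ E] {L : Submodule ℤ E}

theorem weightedTheta_add_two (hL : ∀ x ∈ L, ∃ n : ℤ, ‖x‖ ^ 2 = n) (c : E → ℂ) (τ : ℂ) :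
    weightedTheta L c 0 (τ + 2) 0 = weightedTheta L c 0 τ 0 := by
  refine tsum_congr fun x => ?_
  obtain ⟨n, hn⟩ := hL x x.2
  have hn' : (‖(x : E)‖ : ℂ) ^ 2 = n := by exact_mod_cast hn
  rw [hn']
  congr 1
  refine Complex.exp_eq_exp_iff_exists_int.2 ⟨n, by ring⟩

variable [FiniteDimensional ℝ E]

theorem IsUnimodular.norm_sq_characteristic (hL : IsUnimodular L) (hE : finrank ℝ E = 24) {w : E}
    (hw : ∀ x ∈ L, ∃ n : ℤ, inner ℝ x w = ‖x‖ ^ 2 + 2 * n) : ∃ n : ℤ, ‖w‖ ^ 2 = 8 * n := by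
  have := hL.discreteTopology
  have := hL.isZLattice
  set Θ : ℂ → ℂ := fun τ => weightedTheta L (fun _ => 1) 0 τ 0 with hΘ
  set Θs : ℂ → ℂ := fun τ => ∑' x : L, cexp (π * I * τ * (‖(1 / 2 : ℝ) • w + x‖ : ℂ) ^ 2) with hΘs
  have hnorm : ∀ x ∈ L, ∃ n : ℤ, ‖x‖ ^ 2 = n := fun x hx => by
    simpa only [real_inner_self_eq_norm_sq] using hL.inner_int hx hx
  have h1 : ∀ τ : ℂ, 0 < τ.im → Θs τ = (τ ^ 12)⁻¹ * Θ (1 - τ⁻¹) := by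
    intro τ hτ
    simp only [hΘs, hΘ]
    rw [hL.tsum_gaussian_add hE hτ, weightedTheta]
    congr 1
    refine tsum_congr fun x => ?_
    obtain ⟨n, hn⟩ := hw x x.2
    rw [one_mul, real_inner_smul_right, hn]
    refine Complex.exp_eq_exp_iff_exists_int.2 ⟨n, ?_⟩
    push_cast
    ring
  have h2 : ∀ τ : ℂ, 0 < τ.im → Θ (-τ⁻¹) = τ ^ 12 * Θ τ := by
    intro τ hτ
    have hτ0 : τ ≠ 0 := by rintro rfl; simp at hτ
    have h := hL.weightedTheta_one hE hτ 0
    have hβ : ∀ β σ : ℂ, weightedTheta L (fun _ => 1) β σ 0 = Θ σ := by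
      intro β σ
      simp [hΘ, weightedTheta]
    rw [hβ, hβ] at h
    field_simp at h
    simp only [norm_zero, ofReal_zero, ne_eq, OfNat.ofNat_ne_zero, not_false_eq_true, zero_pow,
      mul_zero, Complex.exp_zero, mul_one, one_div] at h
    exact h.symm
  have h3 : Θs (I + 1) = Θs I := by
    have hI : 0 < I.im := by simp
    have hI1 : 0 < (I + 1).im := by simp
    have hI0 : I + 1 ≠ 0 := by
      intro h
      rw [h] at hI1
      simp at hI1
    have hσ : 0 < (-1 - I⁻¹).im := by simp
    rw [h1 _ hI, h1 _ hI1]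
    have e3 : (-1 - I⁻¹) = -(I + 1) * I⁻¹ := by
      have hI' := I_ne_zero
      field_simp
      ring
    have e1 : 1 - (I + 1)⁻¹ = -(-1 - I⁻¹)⁻¹ := by
      rw [e3, mul_inv, inv_inv, inv_neg]
      field_simp
      ring
    have e2 : (1 : ℂ) - I⁻¹ = (-1 - I⁻¹) + 2 := by ring
    rw [e1, h2 _ hσ, e2]
    simp only [hΘ, weightedTheta_add_two hnorm]
    rw [← mul_assoc]
    congr 1
    rw [e3, mul_pow]
    field_simp
  have h4 : Θs (I + 1) = cexp (π * I * (‖w‖ ^ 2 / 4)) * Θs I := by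
    simp only [hΘs]
    rw [← tsum_mul_left]
    refine tsum_congr fun x => ?_
    obtain ⟨n, hn⟩ := hw x x.2
    obtain ⟨m, hm⟩ := hnorm x x.2
    have hx : (‖(1 / 2 : ℝ) • w + x‖ : ℂ) ^ 2 = 2 * (m + n) + ‖w‖ ^ 2 / 4 := by
      have h := norm_add_sq_real ((1 / 2 : ℝ) • w) (x : E)
      rw [real_inner_smul_left, real_inner_comm, hn, hm, norm_smul, mul_pow] at h
      have h' : ‖(1 / 2 : ℝ) • w + x‖ ^ 2 = 2 * (m + n) + ‖w‖ ^ 2 / 4 := by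
        rw [h]; norm_num; ring
      exact_mod_cast h'
    rw [← Complex.exp_add, hx]
    refine Complex.exp_eq_exp_iff_exists_int.2 ⟨m + n, ?_⟩
    push_cast
    ring
  have h5 : Θs I ≠ 0 := by
    have e : ∀ x : L, cexp (π * I * I * (‖(1 / 2 : ℝ) • w + x‖ : ℂ) ^ 2) =
        (rexp (-π * ‖(1 / 2 : ℝ) • w + x‖ ^ 2) : ℂ) := by
      intro x
      push_cast
      congr 1
      rw [mul_assoc (π : ℂ), I_mul_I]; ring
    have hs : Summable fun x : L => rexp (-π * ‖(1 / 2 : ℝ) • w + x‖ ^ 2) := by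
      refine Summable.of_norm_bounded (ZLattice.summable_norm_pow_mul_exp L 0 Real.pi_pos
        (2 * π * ‖(1 / 2 : ℝ) • w‖)) fun x => ?_
      have := norm_cexp_gaussian_le (τ := I) (by simp) (x := (x : E)) (le_refl ‖(1 / 2 : ℝ) • w‖)
      rw [e, Complex.norm_real] at this
      simpa only [I_im, mul_one, pow_zero, one_mul] using this
    simp only [hΘs, e]
    rw [← Complex.ofReal_tsum]
    exact_mod_cast (hs.tsum_pos (fun _ => (Real.exp_pos _).le) 0 (Real.exp_pos _)).ne'
  rw [h3] at h4
  have h6 : cexp (π * I * (‖w‖ ^ 2 / 4)) = 1 := by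
    rcases mul_eq_right₀ h5 |>.1 h4.symm with h
    exact h
  obtain ⟨n, hn⟩ := Complex.exp_eq_one_iff.1 h6
  refine ⟨n, ?_⟩
  have hpi : (π : ℂ) ≠ 0 := by exact_mod_cast Real.pi_ne_zero
  have hI' := I_ne_zero
  have : (‖w‖ : ℂ) ^ 2 = 8 * n := by
    have h0 : (π * I : ℂ) ≠ 0 := mul_ne_zero hpi hI'
    apply mul_left_cancel₀ h0
    linear_combination 4 * hn
  exact_mod_cast this

end Characteristic

section Neighbor

open Module Submodule

variable {E : Type*} [NormedAddCommGroup E] [InnerProductSpace ℝ E] [FiniteDimensional ℝ E]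
  {L : Submodule ℤ E}

theorem IsUnimodular.exists_characteristic (hL : IsUnimodular L) :
    ∃ w ∈ L, ∀ x ∈ L, ∃ n : ℤ, inner ℝ x w = ‖x‖ ^ 2 + 2 * n := by
  have := hL.discreteTopology
  have := hL.isZLattice
  have : Module.Finite ℤ L := ZLattice.module_finite ℝ L
  have : Free ℤ L := ZLattice.module_free ℝ L
  let b := Free.chooseBasis ℤ L
  obtain ⟨w, hw⟩ := (b.ofZLatticeBasis ℝ L).exists_inner_eq fun i => ‖(b i : E)‖ ^ 2
  have hw : ∀ i, inner ℝ w (b i : E) = ‖(b i : E)‖ ^ 2 := fun i => by simpa using hw i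
  have hint : ∀ x : L, ∃ n : ℤ, ‖(x : E)‖ ^ 2 = n := fun x => by
    simpa only [real_inner_self_eq_norm_sq] using hL.inner_int x.2 x.2
  refine ⟨w, hL.mem_of_basis b fun i => (hint (b i)).imp fun n hn => (hw i).trans hn,
    fun x hx => ?_⟩
  have hx' : (⟨x, hx⟩ : L) ∈ span ℤ (Set.range b) := by rw [b.span_eq]; trivial
  suffices ∀ y ∈ span ℤ (Set.range b), ∃ n : ℤ, inner ℝ (y : E) w = ‖(y : E)‖ ^ 2 + 2 * n from
    this _ hx'
  intro y hy
  induction hy using Submodule.span_induction with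
  | mem y hy =>
    obtain ⟨i, rfl⟩ := hy
    exact ⟨0, by rw [real_inner_comm, hw]; simp⟩
  | zero => exact ⟨0, by simp⟩
  | add y z _ _ hy hz =>
    obtain ⟨n, hn⟩ := hy
    obtain ⟨m, hm⟩ := hz
    obtain ⟨k, hk⟩ := hL.inner_int y.2 z.2
    refine ⟨n + m - k, ?_⟩
    push_cast
    rw [inner_add_left, norm_add_sq_real, hn, hm, hk]
    ring
  | smul a y _ hy =>
    obtain ⟨n, hn⟩ := hy
    obtain ⟨m, hm⟩ := hint y
    obtain ⟨j, hj⟩ : ∃ j : ℤ, a - a ^ 2 = 2 * j := by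
      have := Int.even_mul_pred_self a
      obtain ⟨r, hr⟩ := this
      exact ⟨-r, by linear_combination -hr⟩
    refine ⟨a * n + j * m, ?_⟩
    have hj' : (a : ℝ) - a ^ 2 = 2 * j := by exact_mod_cast hj
    push_cast
    rw [← Int.cast_smul_eq_zsmul ℝ, real_inner_smul_left, norm_smul, mul_pow, hn, hm,
      Real.norm_eq_abs, sq_abs]
    linear_combination (m : ℝ) * hj'

theorem IsUnimodular.exists_even_neighbor (hL : IsUnimodular L) (hE : finrank ℝ E = 24) {e : E}
    (he : e ∈ L) (he1 : ‖e‖ = 1) :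
    ∃ N : Submodule ℤ E, IsUnimodular N ∧ (∀ x ∈ N, ∃ n : ℤ, ‖x‖ ^ 2 = 2 * n) ∧
      (∀ x, (∃ n : ℤ, inner ℝ x e = n) → (x ∈ N ↔ x ∈ L ∧ ∃ n : ℤ, ‖x‖ ^ 2 = 2 * n)) ∧
      ∀ x ∈ N, ∃ n : ℤ, 2 * inner ℝ x e = n := by
  obtain ⟨w, hwL, hw⟩ := hL.exists_characteristic
  obtain ⟨m, hm⟩ := hL.norm_sq_characteristic hE hw
  set h : E := (1 / 2 : ℝ) • w with hh
  have hwh : w = (2 : ℤ) • h := by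
    rw [hh, ← Int.cast_smul_eq_zsmul ℝ, smul_smul]; norm_num
  have hh2 : inner ℝ h h = 2 * (m : ℝ) := by
    rw [hh, real_inner_smul_left, real_inner_smul_right, real_inner_self_eq_norm_sq, hm]; ring
  have hw : ∀ x ∈ L, ∃ n : ℤ, 2 * inner ℝ x h = ‖x‖ ^ 2 + 2 * n := by
    intro x hx
    obtain ⟨n, hn⟩ := hw x hx
    exact ⟨n, by rw [hh, real_inner_smul_right, ← hn]; ring⟩
  clear_value h
  let L₀ : Submodule ℤ E :=
    { carrier := {x | x ∈ L ∧ ∃ n : ℤ, inner ℝ x h = n}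
      add_mem' := fun {x y} ⟨hx, n, hn⟩ ⟨hy, k, hk⟩ =>
        ⟨L.add_mem hx hy, n + k, by rw [inner_add_left, hn, hk]; push_cast; rfl⟩
      zero_mem' := ⟨L.zero_mem, 0, by simp⟩
      smul_mem' := fun a x ⟨hx, n, hn⟩ => ⟨L.smul_mem a hx, a * n, by
        rw [← Int.cast_smul_eq_zsmul ℝ, real_inner_smul_left, hn]; push_cast; rfl⟩ }
  have hL₀ : ∀ x, x ∈ L₀ ↔ x ∈ L ∧ ∃ n : ℤ, inner ℝ x h = n := fun x => Iff.rfl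
  have heven : ∀ x ∈ L, (x ∈ L₀ ↔ ∃ n : ℤ, ‖x‖ ^ 2 = 2 * n) := by
    intro x hx
    obtain ⟨n, hn⟩ := hw x hx
    rw [hL₀]
    constructor
    · rintro ⟨_, k, hk⟩
      exact ⟨k - n, by push_cast; linear_combination 2 * hk - hn⟩
    · rintro ⟨k, hk⟩
      exact ⟨hx, k + n, by push_cast; linear_combination (hn + hk) / 2⟩
  let N : Submodule ℤ E := L₀ ⊔ span ℤ {h}
  have hN : ∀ x, x ∈ N ↔ ∃ y ∈ L₀, ∃ n : ℤ, x = y + n • h := by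
    intro x
    simp only [N, mem_sup, mem_span_singleton]
    constructor
    · rintro ⟨y, hy, _, ⟨n, rfl⟩, rfl⟩
      exact ⟨y, hy, n, rfl⟩
    · rintro ⟨y, hy, n, rfl⟩
      exact ⟨y, hy, _, ⟨n, rfl⟩, rfl⟩
  have hL₀N : ∀ x ∈ L₀, x ∈ N := fun x hx => (le_sup_left : L₀ ≤ N) hx
  have hhN : h ∈ N := (hN h).2 ⟨0, L₀.zero_mem, 1, by simp⟩
  have hinner : ∀ (y z : E) (n k : ℤ), inner ℝ (y + n • h) (z + k • h) =
      inner ℝ y z + k * inner ℝ y h + n * inner ℝ z h + n * k * (2 * m) := by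
    intro y z n k
    rw [← Int.cast_smul_eq_zsmul ℝ, ← Int.cast_smul_eq_zsmul ℝ, inner_add_left, inner_add_right,
      inner_add_right, real_inner_smul_left, real_inner_smul_left, real_inner_smul_right,
      real_inner_smul_right, hh2, real_inner_comm z h]
    ring
  have hNint : ∀ x ∈ N, ∀ y ∈ N, ∃ n : ℤ, inner ℝ x y = n := by
    intro x hx x' hx'
    obtain ⟨y, ⟨hyL, p, hp⟩, n, rfl⟩ := (hN x).1 hx
    obtain ⟨z, ⟨hzL, q, hq⟩, k, rfl⟩ := (hN x').1 hx'
    obtain ⟨r, hr⟩ := hL.inner_int hyL hzL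
    exact ⟨r + k * p + n * q + n * k * (2 * m), by rw [hinner, hr, hp, hq]; push_cast; ring⟩
  obtain ⟨j, hj⟩ : ∃ j : ℤ, 2 * inner ℝ h e = 2 * j + 1 := by
    obtain ⟨n, hn⟩ := hw e he
    exact ⟨n, by rw [real_inner_comm, hn, he1]; ring⟩
  have h2e : ∀ x ∈ N, ∃ n : ℤ, 2 * inner ℝ x e = n := by
    intro x hx
    obtain ⟨y, ⟨hyL, -⟩, n, rfl⟩ := (hN x).1 hx
    obtain ⟨r, hr⟩ := hL.inner_int hyL he
    refine ⟨2 * r + n * (2 * j + 1), ?_⟩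
    rw [inner_add_left, hr, ← Int.cast_smul_eq_zsmul ℝ, real_inner_smul_left]
    push_cast
    linear_combination (n : ℝ) * hj
  have hdual : ∀ x, (∀ y ∈ N, ∃ n : ℤ, inner ℝ x y = n) → (∃ n : ℤ, inner ℝ x e = n) →
      x ∈ L₀ := by
    rintro x hx ⟨n, hn⟩
    refine ⟨(hL.mem_iff x).2 fun y hy => ?_, hx h hhN⟩
    by_cases hy0 : ∃ n : ℤ, ‖y‖ ^ 2 = 2 * n
    · exact hx y (hL₀N y ((heven y hy).2 hy0))
    · have hye : y - e ∈ L₀ := by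
        refine (heven _ (L.sub_mem hy he)).2 ?_
        obtain ⟨p, hp⟩ := hL.inner_int hy hy
        obtain ⟨q, hq⟩ := hL.inner_int hy he
        rw [real_inner_self_eq_norm_sq] at hp
        obtain ⟨r, hr | hr⟩ := p.even_or_odd'
        · exact absurd ⟨r, by rw [hp, hr]; push_cast; rfl⟩ hy0
        · refine ⟨r - q + 1, ?_⟩
          rw [norm_sub_sq_real, hp, hq, hr, he1]
          push_cast
          ring
      obtain ⟨k, hk⟩ := hx _ (hL₀N _ hye)
      exact ⟨k + n, by rw [← sub_add_cancel y e, inner_add_right, hk, hn]; push_cast; rfl⟩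
  have h2L : ∀ x ∈ L, (2 : ℤ) • x ∈ L₀ := by
    intro x hx
    obtain ⟨p, hp⟩ := hL.inner_int hx hx
    rw [real_inner_self_eq_norm_sq] at hp
    refine (heven _ (L.smul_mem 2 hx)).2 ⟨2 * p, ?_⟩
    rw [← Int.cast_smul_eq_zsmul ℝ, norm_smul, mul_pow, hp]
    push_cast
    norm_num
    ring
  refine ⟨N, ⟨?_, fun x => ⟨fun hx => hNint x hx, fun hx => ?_⟩⟩, ?_, ?_, h2e⟩
  · rw [eq_top_iff, ← hL.span_eq_top, span_le]
    intro x hx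
    have h1 : (2 : ℤ) • x ∈ span ℝ (N : Set E) := subset_span (hL₀N _ (h2L x hx))
    have h2 : x = (1 / 2 : ℝ) • (2 : ℤ) • x := by
      rw [← Int.cast_smul_eq_zsmul ℝ, smul_smul]; norm_num
    rw [h2]
    exact smul_mem _ _ h1
  · obtain ⟨n, hn⟩ := hx _ (hL₀N _ (h2L e he))
    rw [← Int.cast_smul_eq_zsmul ℝ, real_inner_smul_right] at hn
    push_cast at hn
    obtain ⟨r, hr | hr⟩ := n.even_or_odd'
    · rw [hr] at hn
      push_cast at hn
      exact hL₀N x (hdual x hx ⟨r, by linear_combination hn / 2⟩)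
    · rw [hr] at hn
      push_cast at hn
      have h1 : x - h ∈ L₀ := by
        refine hdual _ (fun y hy => ?_) ⟨r - j, ?_⟩
        · obtain ⟨p, hp⟩ := hx y hy
          obtain ⟨q, hq⟩ := hNint h hhN y hy
          exact ⟨p - q, by rw [inner_sub_left, hp, hq]; push_cast; rfl⟩
        · rw [inner_sub_left]
          push_cast
          linear_combination hn / 2 - hj / 2
      rw [← sub_add_cancel x h]
      exact N.add_mem (hL₀N _ h1) hhN
  · intro x hx
    obtain ⟨y, hy, n, rfl⟩ := (hN x).1 hx
    obtain ⟨p, hp⟩ := (heven y hy.1).1 hy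
    obtain ⟨q, hq⟩ := hy.2
    refine ⟨p + n * q + n * n * m, ?_⟩
    rw [← real_inner_self_eq_norm_sq, hinner, real_inner_self_eq_norm_sq, hp, hq]
    push_cast
    ring
  · rintro x ⟨k, hk⟩
    constructor
    · intro hx
      suffices x ∈ L₀ from ⟨this.1, (heven x this.1).1 this⟩
      exact hdual x (hNint x hx) ⟨k, hk⟩
    · rintro ⟨hx, h1⟩
      exact hL₀N x ((heven x hx).2 h1)

end Neighbor

section Roots

variable {E : Type*} [NormedAddCommGroup E] [InnerProductSpace ℝ E]

/-- A finite simply laced root system, given by its vectors of norm 2. -/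
structure IsRootSet (R : Finset E) : Prop where
  norm_sq : ∀ a ∈ R, ‖a‖ ^ 2 = 2
  inner_int : ∀ a ∈ R, ∀ b ∈ R, ∃ n : ℤ, inner ℝ a b = n
  neg_mem : ∀ a ∈ R, -a ∈ R
  add_mem : ∀ a ∈ R, ∀ b ∈ R, inner ℝ a b = -1 → a + b ∈ R

/-- The sign function of a choice of positive roots. -/
structure IsRootSign (R : Finset E) (s : E → ℝ) : Prop where
  eq_or : ∀ a ∈ R, s a = 1 ∨ s a = -1
  neg : ∀ a ∈ R, s (-a) = -s a
  add : ∀ a ∈ R, ∀ b ∈ R, a + b ∈ R → s a = s b → s (a + b) = s a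

/-- Refine the sign of a functional `g` by the sign function `s` on the zero set of `g`. -/
noncomputable def lexSign (g : E →ₗ[ℝ] ℝ) (s : E → ℝ) (x : E) : ℝ :=
  if g x = 0 then s x else SignType.sign (g x)

namespace IsRootSet

variable {R : Finset E}

theorem sum_neg (hR : IsRootSet R) (p : E → Prop) [DecidablePred p] {M : Type*} [AddCommMonoid M]
    (F : E → M) : ∑ b ∈ R with p (-b), F b = ∑ b ∈ R with p b, F (-b) := by
  refine Finset.sum_nbij' (fun b => -b) (fun b => -b) ?_ ?_ ?_ ?_ ?_ <;>
    simp +contextual [hR.neg_mem]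

theorem inner_cases (hR : IsRootSet R) {a b : E} (ha : a ∈ R) (hb : b ∈ R) :
    b = a ∨ b = -a ∨ inner ℝ a b = 1 ∨ inner ℝ a b = -1 ∨ inner ℝ a b = 0 := by
  obtain ⟨n, hn⟩ := hR.inner_int a ha b hb
  have h1 : ‖a - b‖ ^ 2 = 4 - 2 * n := by
    rw [norm_sub_sq_real, hn, hR.norm_sq a ha, hR.norm_sq b hb]; ring
  have h2 : ‖a + b‖ ^ 2 = 4 + 2 * n := by
    rw [norm_add_sq_real, hn, hR.norm_sq a ha, hR.norm_sq b hb]; ring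
  have h3 : n ≤ 2 := by
    have : (n : ℝ) ≤ 2 := by linarith [sq_nonneg ‖a - b‖]
    exact_mod_cast this
  have h4 : -2 ≤ n := by
    have : (-2 : ℝ) ≤ n := by linarith [sq_nonneg ‖a + b‖]
    exact_mod_cast this
  rw [hn]
  interval_cases n
  · right; left
    have : ‖a + b‖ ^ 2 = 0 := by rw [h2]; norm_num
    exact eq_neg_of_add_eq_zero_right (norm_eq_zero.1 (by simpa using this))
  · norm_num
  · norm_num
  · norm_num
  · left
    have : ‖a - b‖ ^ 2 = 0 := by rw [h1]; norm_num
    exact (sub_eq_zero.1 (norm_eq_zero.1 (by simpa using this))).symm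

theorem sum_even (hR : IsRootSet R) {a : E} (ha : a ∈ R) (F : E → ℝ)
    (hF : ∀ b ∈ R, F (-b) = F b) (hF0 : ∀ b, inner ℝ a b = 0 → F b = 0) :
    ∑ b ∈ R, F b = 2 * F a + 2 * ∑ b ∈ R with inner ℝ a b = -1, F b := by
  classical
  have haa : inner ℝ a a = (2 : ℝ) := by rw [real_inner_self_eq_norm_sq, hR.norm_sq a ha]
  have ha0 : a ≠ -a := by
    intro h
    have h1 : inner ℝ a a = -inner ℝ a a := by
      rw [← inner_neg_right, ← h]
    linarith
  have h1 : ∑ b ∈ R, F b = ∑ b ∈ R, ((if b = a then F b else 0) + (if b = -a then F b else 0) +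
      (if inner ℝ a b = 1 then F b else 0) + if inner ℝ a b = -1 then F b else 0) := by
    refine Finset.sum_congr rfl fun b hb => ?_
    rcases hR.inner_cases ha hb with rfl | rfl | h | h | h
    · rw [haa, if_neg ha0]; norm_num
    · rw [inner_neg_right, haa, if_neg ha0.symm]; norm_num
    all_goals
      have h3 : b ≠ a := by rintro rfl; linarith
      have h4 : b ≠ -a := by rintro rfl; rw [inner_neg_right] at h; linarith
      norm_num [h, h3, h4]
    exact hF0 b h
  have h2 : ∑ b ∈ R with inner ℝ a b = 1, F b = ∑ b ∈ R with inner ℝ a b = -1, F b := by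
    have := hR.sum_neg (fun b => inner ℝ a b = -1) F
    simp only [inner_neg_right, neg_inj] at this
    rw [this]
    exact Finset.sum_congr rfl fun b hb => hF b (Finset.mem_filter.1 hb).1
  rw [h1, Finset.sum_add_distrib, Finset.sum_add_distrib, Finset.sum_add_distrib,
    Finset.sum_ite_eq' R a, Finset.sum_ite_eq' R (-a), if_pos ha, if_pos (hR.neg_mem a ha), hF a ha,
    ← Finset.sum_filter, ← Finset.sum_filter, h2]
  ring

theorem sum_pair_sign (hR : IsRootSet R) {s : E → ℝ} (hs : IsRootSign R s) :
    3 * ∑ a ∈ R, ∑ b ∈ R with inner ℝ a b = -1, s a * s b =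
      -∑ a ∈ R, ∑ b ∈ R with inner ℝ a b = -1, (1 : ℝ) := by
  let P : Finset (E × E) := {p ∈ R ×ˢ R | inner ℝ p.1 p.2 = -1}
  have hP : ∀ F : E → E → ℝ, ∑ a ∈ R, ∑ b ∈ R with inner ℝ a b = -1, F a b =
      ∑ p ∈ P, F p.1 p.2 := by
    intro F
    simp only [P, Finset.sum_filter, Finset.sum_product]
  have hmem : ∀ a b, (a, b) ∈ P ↔ a ∈ R ∧ b ∈ R ∧ inner ℝ a b = -1 := by
    intro a b
    simp [P, and_assoc]
  have hrot : ∀ a b, (a, b) ∈ P → (b, -a - b) ∈ P := by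
    intro a b hab
    obtain ⟨ha, hb, h⟩ := (hmem a b).1 hab
    refine (hmem _ _).2 ⟨hb, ?_, ?_⟩
    · rw [← neg_add']
      exact hR.neg_mem _ (hR.add_mem a ha b hb h)
    · rw [inner_sub_right, inner_neg_right, real_inner_comm, h, real_inner_self_eq_norm_sq,
        hR.norm_sq b hb]
      norm_num
  have hthird : ∀ a b : E, -b - (-a - b) = a := fun a b => by abel
  have hinv : ∀ F : E → E → ℝ, ∑ p ∈ P, F p.1 p.2 = ∑ p ∈ P, F p.2 (-p.1 - p.2) := by
    intro F
    symm
    refine Finset.sum_nbij' (fun p => (p.2, -p.1 - p.2)) (fun p => (-p.1 - p.2, p.1))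
      (fun p hp => hrot _ _ hp) (fun p hp => ?_) (fun p _ => ?_) (fun p _ => ?_) fun p _ => rfl
    · have := hrot _ _ (hrot _ _ hp)
      rwa [hthird] at this
    · exact Prod.ext (hthird _ _) rfl
    · exact Prod.ext rfl (show -(-p.1 - p.2) - p.1 = p.2 by abel)
  have h1 := hinv fun a b => s a * s b
  have h2 := hinv fun a b => s b * s (-a - b)
  rw [hP, hP, ← Finset.sum_neg_distrib]
  have h3 : ∑ p ∈ P, (s p.1 * s p.2 + s p.2 * s (-p.1 - p.2) +
      s (-p.1 - p.2) * s (-p.2 - (-p.1 - p.2))) = ∑ p ∈ P, -(1 : ℝ) := by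
    refine Finset.sum_congr rfl fun p hp => ?_
    obtain ⟨ha, hb, h⟩ := (hmem p.1 p.2).1 hp
    have hab := hR.add_mem _ ha _ hb h
    rw [← neg_add', hs.neg _ hab, show -p.2 - -(p.1 + p.2) = p.1 by abel]
    rcases hs.eq_or _ ha with h1 | h1 <;> rcases hs.eq_or _ hb with h2 | h2
    · rw [hs.add _ ha _ hb hab (h1.trans h2.symm), h1, h2]; norm_num
    · rw [h1, h2]; ring
    · rw [h1, h2]; ring
    · rw [hs.add _ ha _ hb hab (h1.trans h2.symm), h1, h2]; norm_num
  rw [Finset.sum_add_distrib, Finset.sum_add_distrib] at h3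
  linarith

theorem norm_sq_sum_sign (hR : IsRootSet R) {s : E → ℝ} (hs : IsRootSign R s) :
    ‖∑ a ∈ R, s a • a‖ ^ 2 =
      4 * R.card + 2 / 3 * ∑ a ∈ R, ∑ b ∈ R with inner ℝ a b = -1, (1 : ℝ) := by
  have h1 : ‖∑ a ∈ R, s a • a‖ ^ 2 = ∑ a ∈ R, ∑ b ∈ R, s a * s b * inner ℝ a b := by
    rw [← real_inner_self_eq_norm_sq, sum_inner]
    refine Finset.sum_congr rfl fun a _ => ?_
    rw [inner_sum]
    refine Finset.sum_congr rfl fun b _ => ?_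
    rw [real_inner_smul_left, real_inner_smul_right, mul_assoc]
  have h2 : ∀ a ∈ R, ∑ b ∈ R, s a * s b * inner ℝ a b =
      4 - 2 * ∑ b ∈ R with inner ℝ a b = -1, s a * s b := by
    intro a ha
    rw [hR.sum_even ha _ (fun b hb => by rw [hs.neg b hb, inner_neg_right]; ring)
      fun b hb => by rw [hb, mul_zero], sub_eq_add_neg, ← mul_neg, ← Finset.sum_neg_distrib,
      real_inner_self_eq_norm_sq, hR.norm_sq a ha]
    congr 1
    · rcases hs.eq_or a ha with h | h <;> rw [h] <;> norm_num
    · congr 1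
      refine Finset.sum_congr rfl fun b hb => ?_
      rw [(Finset.mem_filter.1 hb).2]; ring
  rw [h1, Finset.sum_congr rfl h2, Finset.sum_sub_distrib, ← Finset.mul_sum, Finset.sum_const,
    nsmul_eq_mul]
  linarith [hR.sum_pair_sign hs]

theorem even_card_inner_eq_neg_one (hR : IsRootSet R) {a : E} (ha : a ∈ R) :
    Even ({b ∈ R | inner ℝ a b = -1} : Finset E).card := by
  have haa : inner ℝ a a = (2 : ℝ) := by rw [real_inner_self_eq_norm_sq, hR.norm_sq a ha]
  have hmem : ∀ b ∈ R, inner ℝ a b = -1 → -a - b ∈ R ∧ inner ℝ a (-a - b) = -1 := by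
    intro b hb h
    refine ⟨?_, ?_⟩
    · rw [← neg_add']
      exact hR.neg_mem _ (hR.add_mem a ha b hb h)
    · rw [inner_sub_right, inner_neg_right, haa, h]; norm_num
  have h0 : ∑ b ∈ R with inner ℝ a b = -1, (1 : ZMod 2) = 0 := by
    refine Finset.sum_involution (fun b _ => -a - b) (fun _ _ => by decide) (fun b hb _ h => ?_)
      (fun b hb => ?_) fun b _ => by abel
    · obtain ⟨hbR, hb⟩ := Finset.mem_filter.1 hb
      have h1 : inner ℝ b (-a - b) = inner ℝ b b := by rw [h]
      rw [inner_sub_right, inner_neg_right, real_inner_comm, hb, real_inner_self_eq_norm_sq,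
        hR.norm_sq b hbR] at h1
      norm_num at h1
    · obtain ⟨hbR, hb⟩ := Finset.mem_filter.1 hb
      exact Finset.mem_filter.2 (hmem b hbR hb)
  rw [Finset.sum_const, nsmul_eq_mul, mul_one] at h0
  exact (ZMod.natCast_eq_zero_iff_even).1 h0

theorem exists_int_of_sum_inner_smul [FiniteDimensional ℝ E] (hR : IsRootSet R)
    (hE : Module.finrank ℝ E = 24) {c : ℝ} (hc : ∀ w : E, ∑ x ∈ R, inner ℝ x w • x = c • w) :
    ∃ h : ℤ, c = 2 * h ∧
      ∀ s, IsRootSign R s → ‖∑ a ∈ R, s a • a‖ ^ 2 = 32 * h * (h + 1) := by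
  have hcard : (R.card : ℝ) = 12 * c := by
    have h1 := sum_norm_sq_eq_of_sum_inner_smul hc
    rw [Finset.sum_congr rfl hR.norm_sq, hE, Finset.sum_const, nsmul_eq_mul] at h1
    push_cast at h1
    linarith
  have hp : ∀ a ∈ R, ∑ b ∈ R with inner ℝ a b = -1, (1 : ℝ) = c - 4 := by
    intro a ha
    have haa : inner ℝ a a = (2 : ℝ) := by rw [real_inner_self_eq_norm_sq, hR.norm_sq a ha]
    have h1 := hR.sum_even ha (fun b => inner ℝ a b ^ 2)
      (fun b _ => by rw [inner_neg_right, neg_sq]) fun b hb => by rw [hb]; norm_num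
    have h2 : ∑ b ∈ R, inner ℝ a b ^ 2 = 2 * c := by
      have := congrArg (fun v => inner ℝ v a) (hc a)
      simp only [sum_inner, real_inner_smul_left, haa] at this
      rw [mul_comm, ← this]
      exact Finset.sum_congr rfl fun b _ => by rw [real_inner_comm, pow_two]
    have h3 : ∑ b ∈ R with inner ℝ a b = -1, inner ℝ a b ^ 2 =
        ∑ b ∈ R with inner ℝ a b = -1, (1 : ℝ) := by
      refine Finset.sum_congr rfl fun b hb => ?_
      rw [(Finset.mem_filter.1 hb).2]; norm_num
    rw [h2, h3, haa] at h1
    linarith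
  obtain ⟨h, hh⟩ : ∃ h : ℤ, c = 2 * h := by
    rcases R.eq_empty_or_nonempty with rfl | ⟨a, ha⟩
    · exact ⟨0, by simpa using hcard.symm⟩
    · obtain ⟨k, hk⟩ := hR.even_card_inner_eq_neg_one ha
      have h1 := hp a ha
      rw [Finset.sum_const, hk, nsmul_eq_mul] at h1
      push_cast at h1
      exact ⟨k + 2, by push_cast; linarith⟩
  refine ⟨h, hh, fun s hs => ?_⟩
  rw [hR.norm_sq_sum_sign hs, Finset.sum_congr rfl hp, Finset.sum_const, nsmul_eq_mul, hcard, hh]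
  ring

end IsRootSet

theorem isRootSign_lexSign {R : Finset E} {g : E →ₗ[ℝ] ℝ} {s : E → ℝ}
    (hs : IsRootSign {a ∈ R | g a = 0} s) : IsRootSign R (lexSign g s) := by
  have hmem : ∀ {a}, a ∈ R → g a = 0 → a ∈ ({a ∈ R | g a = 0} : Finset E) :=
    fun ha h => Finset.mem_filter.2 ⟨ha, h⟩
  have hpos : ∀ {a}, 0 < g a → lexSign g s a = 1 := fun h => by simp [lexSign, h.ne', h]
  have hneg : ∀ {a}, g a < 0 → lexSign g s a = -1 := fun h => by simp [lexSign, h.ne, h]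
  have hzero : ∀ {a}, g a = 0 → lexSign g s a = s a := fun h => by simp [lexSign, h]
  refine ⟨fun a ha => ?_, fun a ha => ?_, fun a ha b hb hab h => ?_⟩
  · rcases lt_trichotomy (g a) 0 with h | h | h
    · exact .inr (hneg h)
    · rw [hzero h]
      exact hs.eq_or a (hmem ha h)
    · exact .inl (hpos h)
  · rcases lt_trichotomy (g a) 0 with h | h | h
    · rw [hneg h, hpos (by simpa using h), neg_neg]
    · rw [hzero h, hzero (by simpa using h)]
      exact hs.neg a (hmem ha h)
    · rw [hpos h, hneg (by simpa using h)]
  · rcases lt_trichotomy (g a) 0 with h1 | h1 | h1 <;>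
      rcases lt_trichotomy (g b) 0 with h2 | h2 | h2
    · rw [hneg h1, hneg (by rw [map_add]; linarith)]
    · rw [hneg h1, hneg (by rw [map_add]; linarith)]
    · rw [hneg h1, hpos h2] at h; norm_num at h
    · rw [h, hneg h2, hneg (by rw [map_add]; linarith)]
    · have h3 : g (a + b) = 0 := by rw [map_add, h1, h2, add_zero]
      rw [hzero h1, hzero h2] at h
      rw [hzero h1, hzero h3]
      exact hs.add a (hmem ha h1) b (hmem hb h2) (hmem hab h3) h
    · rw [h, hpos h2, hpos (by rw [map_add]; linarith)]
    · rw [hpos h1, hneg h2] at h; norm_num at h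
    · rw [hpos h1, hpos (by rw [map_add]; linarith)]
    · rw [hpos h1, hpos (by rw [map_add]; linarith)]

end Roots

section Layers

open Module

theorem IsRootSign.mono {E : Type*} [NormedAddCommGroup E] {R R' : Finset E} {s : E → ℝ}
    (hs : IsRootSign R s) (h : R' ⊆ R) : IsRootSign R' s :=
  ⟨fun a ha => hs.eq_or a (h ha), fun a ha => hs.neg a (h ha),
    fun a ha b hb hab => hs.add a (h ha) b (h hb) (h hab)⟩

variable {E : Type*} [NormedAddCommGroup E] [InnerProductSpace ℝ E]

theorem even_card_of_neg_mem {U : Finset E} (hU : ∀ x ∈ U, -x ∈ U) (h0 : (0 : E) ∉ U) :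
    Even U.card := by
  have : IsAddTorsionFree E := .of_isTorsionFree ℝ E
  have h1 : ∑ b ∈ U, (1 : ZMod 2) = 0 := by
    refine Finset.sum_involution (fun b _ => -b) (fun _ _ => by decide) (fun b hb _ h => ?_)
      hU fun b _ => neg_neg b
    exact h0 (self_eq_neg.1 h.symm ▸ hb)
  rw [Finset.sum_const, nsmul_eq_mul, mul_one] at h1
  exact ZMod.natCast_eq_zero_iff_even.1 h1

theorem sum_layer_one {R U : Finset E} {e : E} (hU : ∀ x ∈ U, -x ∈ U)
    (hRU : ∀ r, r - e ∈ U ↔ r ∈ R ∧ inner ℝ e r = 1) :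
    ∑ r ∈ R with inner ℝ e r = 1, r = (U.card : ℝ) • e := by
  have : IsAddTorsionFree E := .of_isTorsionFree ℝ E
  have h0 : ∑ u ∈ U, u = 0 := by
    have h1 : ∑ u ∈ U, u = ∑ u ∈ U, -u :=
      Finset.sum_nbij' (fun u => -u) (fun u => -u) hU hU (by simp) (by simp) (by simp)
    rw [Finset.sum_neg_distrib] at h1
    exact self_eq_neg.1 h1
  have h2 : ∑ r ∈ R with inner ℝ e r = 1, r = ∑ u ∈ U, (u + e) := by
    refine Finset.sum_nbij' (fun r => r - e) (fun u => u + e) (fun r hr => ?_) (fun u hu => ?_)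
      (by simp) (by simp) (by simp)
    · exact (hRU r).2 (Finset.mem_filter.1 hr)
    · exact Finset.mem_filter.2 ((hRU _).1 (by simpa using hu))
  rw [h2, Finset.sum_add_distrib, h0, zero_add, Finset.sum_const, Nat.cast_smul_eq_nsmul]

namespace IsRootSet

variable {R : Finset E} {e : E}

theorem sum_lexSign_smul (hR : IsRootSet R) (s : E → ℝ)
    (h : ∀ r ∈ R, inner ℝ e r = 0 ∨ inner ℝ e r = 1 ∨ inner ℝ e r = -1) :
    ∑ r ∈ R, lexSign (innerₗ E e) s r • r =
      ∑ r ∈ R with inner ℝ e r = 0, s r • r + (2 : ℝ) • ∑ r ∈ R with inner ℝ e r = 1, r := by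
  have h1 := hR.sum_neg (fun r => inner ℝ e r = 1) fun r => -r
  simp only [neg_neg, inner_neg_right] at h1
  rw [two_smul]
  nth_rewrite 2 [← h1]
  simp only [Finset.sum_filter, ← Finset.sum_add_distrib]
  refine Finset.sum_congr rfl fun r hr => ?_
  rcases h r hr with h | h | h <;> norm_num [lexSign, h]

theorem sum_lexSign_smul_of_half (hR : IsRootSet R) (s : E → ℝ)
    (h : ∀ r ∈ R, inner ℝ e r = 0 ∨ inner ℝ e r = 1 / 2 ∨ inner ℝ e r = -(1 / 2) ∨
      inner ℝ e r = 1 ∨ inner ℝ e r = -1) :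
    ∑ r ∈ R, lexSign (innerₗ E e) s r • r =
      ∑ r ∈ R with inner ℝ e r = 0, s r • r + (2 : ℝ) • ∑ r ∈ R, inner ℝ r e • r -
        (2 : ℝ) • ∑ r ∈ R with inner ℝ e r = 1, r := by
  have h1 := hR.sum_neg (fun r => inner ℝ e r = 1) fun r => -r
  simp only [neg_neg, inner_neg_right] at h1
  rw [two_smul _ (Finset.sum (Finset.filter _ _) _)]
  nth_rewrite 2 [← h1]
  simp only [Finset.sum_filter, ← Finset.sum_add_distrib, Finset.smul_sum,
    ← Finset.sum_sub_distrib]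
  refine Finset.sum_congr rfl fun r hr => ?_
  rw [real_inner_comm e r]
  rcases h r hr with h | h | h | h | h <;> norm_num [lexSign, h, smul_smul, two_smul]

end IsRootSet

theorem IsUnimodular.isRootSet {L : Submodule ℤ E} (hL : IsUnimodular L) {R : Finset E}
    (hR : ∀ x, x ∈ R ↔ x ∈ L ∧ ‖x‖ ^ 2 = 2) : IsRootSet R where
  norm_sq a ha := ((hR a).1 ha).2
  inner_int a ha b hb := hL.inner_int ((hR a).1 ha).1 ((hR b).1 hb).1
  neg_mem a ha := (hR _).2 ⟨L.neg_mem ((hR a).1 ha).1, by rw [norm_neg, ((hR a).1 ha).2]⟩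
  add_mem a ha b hb h := (hR _).2 ⟨L.add_mem ((hR a).1 ha).1 ((hR b).1 hb).1, by
    rw [norm_add_sq_real, h, ((hR a).1 ha).2, ((hR b).1 hb).2]; norm_num⟩

theorem norm_sq_sum_smul_add_smul {R : Finset E} {e : E} (he1 : ‖e‖ = 1)
    (h : ∀ r ∈ R, inner ℝ e r = 0) (s : E → ℝ) (t : ℝ) :
    ‖∑ r ∈ R, s r • r + t • e‖ ^ 2 = ‖∑ r ∈ R, s r • r‖ ^ 2 + t ^ 2 := by
  have h1 : inner ℝ (∑ r ∈ R, s r • r) (t • e) = 0 := by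
    rw [sum_inner]
    refine Finset.sum_eq_zero fun r hr => ?_
    rw [real_inner_smul_left, real_inner_smul_right, real_inner_comm, h r hr]
    simp
  rw [norm_add_sq_real, h1, norm_smul, he1, Real.norm_eq_abs, mul_one, sq_abs]
  ring

namespace IsUnimodular

variable {L : Submodule ℤ E} {R R₀ U U₀ : Finset E} {e : E} {s : E → ℝ}

theorem mem_layer_one_iff (he : e ∈ L) (he1 : ‖e‖ = 1)
    (hU : ∀ x, x ∈ U₀ ↔ x ∈ L ∧ ‖x‖ ^ 2 = 1 ∧ inner ℝ e x = 0) (r : E) :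
    r - e ∈ U₀ ↔ (r ∈ L ∧ ‖r‖ ^ 2 = 2) ∧ inner ℝ e r = 1 := by
  have h1 : r - e ∈ L ↔ r ∈ L := L.sub_mem_iff_left he
  rw [hU, h1, norm_sub_sq_real, inner_sub_right, real_inner_self_eq_norm_sq, he1, and_assoc,
    real_inner_comm]
  refine and_congr_right fun _ => ⟨fun ⟨h1, h2⟩ => ⟨?_, ?_⟩, fun ⟨h1, h2⟩ => ⟨?_, ?_⟩⟩ <;> linarith

theorem norm_sq_sum_sign_eq_add (hL : IsUnimodular L) (he : e ∈ L) (he1 : ‖e‖ = 1)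
    (hR : ∀ x, x ∈ R ↔ x ∈ L ∧ ‖x‖ ^ 2 = 2)
    (hR₀ : ∀ x, x ∈ R₀ ↔ x ∈ L ∧ ‖x‖ ^ 2 = 2 ∧ inner ℝ e x = 0)
    (hU : ∀ x, x ∈ U₀ ↔ x ∈ L ∧ ‖x‖ ^ 2 = 1 ∧ inner ℝ e x = 0) (hs : IsRootSign R s) :
    ‖∑ r ∈ R, s r • r‖ ^ 2 = ‖∑ r ∈ R₀, s r • r‖ ^ 2 + 4 * (U₀.card : ℝ) ^ 2 := by
  have hroot := hL.isRootSet hR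
  have hlex : IsRootSign R (lexSign (innerₗ E e) s) :=
    isRootSign_lexSign (hs.mono (Finset.filter_subset _ _))
  have hR' : ({r ∈ R | inner ℝ e r = 0} : Finset E) = R₀ := by
    ext x
    rw [Finset.mem_filter, hR, hR₀, and_assoc]
  have hval : ∀ r ∈ R, inner ℝ e r = 0 ∨ inner ℝ e r = 1 ∨ inner ℝ e r = (-1 : ℝ) := by
    intro r hr
    obtain ⟨n, hn⟩ := hL.inner_int he ((hR r).1 hr).1
    have h1 : (n : ℝ) ^ 2 ≤ 2 := by
      rw [← ((hR r).1 hr).2, ← hn, ← sq_abs]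
      have := abs_real_inner_le_norm e r
      rw [he1, one_mul] at this
      gcongr
    have h1 : n ^ 2 ≤ 2 := by exact_mod_cast h1
    have h2 : n ≤ 1 := by nlinarith
    have h3 : -1 ≤ n := by nlinarith
    rw [hn]
    interval_cases n <;> norm_num
  rw [hroot.norm_sq_sum_sign hs, ← hroot.norm_sq_sum_sign hlex, hroot.sum_lexSign_smul s hval, hR',
    sum_layer_one (U := U₀) (fun x hx => ?_) (fun r => ?_), smul_smul,
    norm_sq_sum_smul_add_smul he1 fun r hr => ((hR₀ r).1 hr).2.2]
  · ring
  · obtain ⟨h1, h2, h3⟩ := (hU x).1 hx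
    exact (hU _).2 ⟨L.neg_mem h1, by rwa [norm_neg], by rw [inner_neg_right, h3, neg_zero]⟩
  · rw [hR, mem_layer_one_iff he he1 hU]

theorem exists_norm_sq_sum_sign_orthogonal [FiniteDimensional ℝ E] (hL : IsUnimodular L)
    (hE : finrank ℝ E = 24) (he : e ∈ L) (he1 : ‖e‖ = 1)
    (hR₀ : ∀ x, x ∈ R₀ ↔ x ∈ L ∧ ‖x‖ ^ 2 = 2 ∧ inner ℝ e x = 0)
    (hU : ∀ x, x ∈ U₀ ↔ x ∈ L ∧ ‖x‖ ^ 2 = 1 ∧ inner ℝ e x = 0) (hs : IsRootSign R₀ s) :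
    ∃ h k : ℤ, (U₀.card : ℝ) = 2 * k ∧
      ‖∑ r ∈ R₀, s r • r‖ ^ 2 = 16 * (2 * h * (h + 1) - (h - k) ^ 2) := by
  obtain ⟨N, hN, heven, hNL, hNe⟩ := hL.exists_even_neighbor hE he he1
  let R := (hN.finite_norm_eq 2).toFinset
  have hR : ∀ x, x ∈ R ↔ x ∈ N ∧ ‖x‖ ^ 2 = 2 := fun x => by simp [R]
  have hroot := hN.isRootSet hR
  obtain ⟨c, hc⟩ := exists_sum_inner_smul_eq_smul
    (fun u v huv => hN.sum_inner_mul_inner_eq_zero hE heven hR huv) he1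
  obtain ⟨h, hh, hnorm⟩ := hroot.exists_int_of_sum_inner_smul hE hc
  have hUneg : ∀ x ∈ U₀, -x ∈ U₀ := fun x hx => by
    obtain ⟨h1, h2, h3⟩ := (hU x).1 hx
    exact (hU _).2 ⟨L.neg_mem h1, by rwa [norm_neg], by rw [inner_neg_right, h3, neg_zero]⟩
  obtain ⟨k, hk⟩ := even_card_of_neg_mem hUneg fun h0 => by simpa using ((hU 0).1 h0).2.1
  have hk' : (U₀.card : ℝ) = 2 * k := by rw [hk]; push_cast; ring
  have hmem : ∀ x (n : ℤ), inner ℝ e x = n → (x ∈ R ↔ x ∈ L ∧ ‖x‖ ^ 2 = 2) := by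
    intro x n hn
    rw [hR, hNL x ⟨n, by rw [real_inner_comm, hn]⟩]
    exact ⟨fun h => ⟨h.1.1, h.2⟩, fun h => ⟨⟨h.1, 1, by rw [h.2]; norm_num⟩, h.2⟩⟩
  have hR' : ({r ∈ R | inner ℝ e r = 0} : Finset E) = R₀ := by
    ext x
    rw [Finset.mem_filter, hR₀, ← and_assoc]
    exact and_congr_left fun h => hmem x 0 (by simpa using h)
  have hlex : IsRootSign R (lexSign (innerₗ E e) s) := isRootSign_lexSign (hR' ▸ hs)
  have hval : ∀ r ∈ R, inner ℝ e r = 0 ∨ inner ℝ e r = 1 / 2 ∨ inner ℝ e r = -(1 / 2) ∨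
      inner ℝ e r = 1 ∨ inner ℝ e r = (-1 : ℝ) := by
    intro r hr
    obtain ⟨n, hn⟩ := hNe r ((hR r).1 hr).1
    rw [real_inner_comm] at hn
    have h1 : (n : ℝ) ^ 2 ≤ 8 := by
      have h2 := abs_real_inner_le_norm e r
      rw [he1, one_mul] at h2
      have h3 : inner ℝ e r ^ 2 ≤ ‖r‖ ^ 2 := by
        rw [← sq_abs]
        gcongr
      rw [((hR r).1 hr).2] at h3
      rw [← hn]
      linarith
    have h1 : n ^ 2 ≤ 8 := by exact_mod_cast h1
    have h2 : n ≤ 2 := by nlinarith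
    have h3 : -2 ≤ n := by nlinarith
    have h4 : inner ℝ e r = (n : ℝ) / 2 := by linarith
    rw [h4]
    interval_cases n <;> norm_num
  refine ⟨h, k, by exact_mod_cast hk', ?_⟩
  have h1 := hnorm _ hlex
  rw [hroot.sum_lexSign_smul_of_half s hval, hR', hc, sum_layer_one (U := U₀) hUneg, hh, hk',
    smul_smul, smul_smul, add_sub_assoc, ← sub_smul,
    norm_sq_sum_smul_add_smul he1 fun r hr => ((hR₀ r).1 hr).2.2] at h1
  · push_cast
    linarith
  · intro r
    rw [mem_layer_one_iff he he1 hU]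
    exact and_congr_left fun h => (hmem r 1 (by simpa using h)).symm

theorem exists_norm_sq_sum_sign [FiniteDimensional ℝ E] (hL : IsUnimodular L)
    (hE : finrank ℝ E = 24) (he : e ∈ L) (he1 : ‖e‖ = 1)
    (hR : ∀ x, x ∈ R ↔ x ∈ L ∧ ‖x‖ ^ 2 = 2) (hU : ∀ x, x ∈ U ↔ x ∈ L ∧ ‖x‖ ^ 2 = 1)
    (hs : IsRootSign R s) :
    ∃ h k : ℤ, (U.card : ℝ) = 2 * k + 2 ∧
      ‖∑ r ∈ R, s r • r‖ ^ 2 = 16 * (2 * h * (h + 1) - (h - k) ^ 2 + k ^ 2) := by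
  classical
  let R₀ : Finset E := {r ∈ R | inner ℝ e r = 0}
  let U₀ : Finset E := {r ∈ U | inner ℝ e r = 0}
  have hR₀ : ∀ x, x ∈ R₀ ↔ x ∈ L ∧ ‖x‖ ^ 2 = 2 ∧ inner ℝ e x = 0 := fun x => by
    rw [Finset.mem_filter, hR, and_assoc]
  have hU₀ : ∀ x, x ∈ U₀ ↔ x ∈ L ∧ ‖x‖ ^ 2 = 1 ∧ inner ℝ e x = 0 := fun x => by
    rw [Finset.mem_filter, hU, and_assoc]
  obtain ⟨h, k, hk, hT⟩ := hL.exists_norm_sq_sum_sign_orthogonal hE he he1 hR₀ hU₀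
    (hs.mono (Finset.filter_subset _ _))
  refine ⟨h, k, ?_, ?_⟩
  · have hee : inner ℝ e e = (1 : ℝ) := by rw [real_inner_self_eq_norm_sq, he1, one_pow]
    have hne : e ≠ -e := fun h => by
      have h1 : inner ℝ e e = -inner ℝ e e := by rw [← inner_neg_right, ← h]
      linarith
    have h1 : ({r ∈ U | ¬inner ℝ e r = 0} : Finset E) = {e, -e} := by
      ext x
      rw [Finset.mem_filter, hU, Finset.mem_insert, Finset.mem_singleton]
      constructor
      · rintro ⟨⟨hx, hx1⟩, hx0⟩
        obtain ⟨n, hn⟩ := hL.inner_int he hx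
        have h2 : ‖e - x‖ ^ 2 = 2 - 2 * n := by rw [norm_sub_sq_real, hn, he1, hx1]; ring
        have h3 : ‖e + x‖ ^ 2 = 2 + 2 * n := by rw [norm_add_sq_real, hn, he1, hx1]; ring
        have h4 : n ≤ 1 := by
          have : (n : ℝ) ≤ 1 := by linarith [sq_nonneg ‖e - x‖]
          exact_mod_cast this
        have h5 : -1 ≤ n := by
          have : (-1 : ℝ) ≤ n := by linarith [sq_nonneg ‖e + x‖]
          exact_mod_cast this
        rw [hn] at hx0
        interval_cases n
        · right
          have : ‖e + x‖ ^ 2 = 0 := by rw [h3]; norm_num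
          exact eq_neg_of_add_eq_zero_right (norm_eq_zero.1 (by simpa using this))
        · simp at hx0
        · left
          have : ‖e - x‖ ^ 2 = 0 := by rw [h2]; norm_num
          exact (sub_eq_zero.1 (norm_eq_zero.1 (by simpa using this))).symm
      · rintro (rfl | rfl)
        · exact ⟨⟨he, by rw [he1, one_pow]⟩, by rw [hee]; norm_num⟩
        · exact ⟨⟨L.neg_mem he, by rw [norm_neg, he1, one_pow]⟩,
            by rw [inner_neg_right, hee]; norm_num⟩
    have h2 := Finset.card_filter_add_card_filter_not (s := U) fun r => inner ℝ e r = 0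
    rw [h1, Finset.card_pair hne] at h2
    rw [← h2, ← hk]
    push_cast
    rfl
  · rw [hL.norm_sq_sum_sign_eq_add he he1 hR hR₀ hU₀ hs, hT, hk]
    ring

theorem orthogonal (hL : IsUnimodular L) (he : e ∈ L) (he1 : ‖e‖ = 1) :
    IsUnimodular (L.comap ((Submodule.subtype (ℝ ∙ e)ᗮ).restrictScalars ℤ)) := by
  have hee : inner ℝ e e = (1 : ℝ) := by rw [real_inner_self_eq_norm_sq, he1, one_pow]
  let π : E →ₗ[ℝ] (ℝ ∙ e)ᗮ := (LinearMap.id - (innerₗ E e).smulRight e).codRestrict _ fun x => by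
    rw [Submodule.mem_orthogonal_singleton_iff_inner_right]
    simp [inner_sub_right, real_inner_smul_right, he1]
  have hπ : ∀ x, (π x : E) = x - inner ℝ e x • e := fun x => rfl
  have hπL : ∀ x ∈ L, (π x : E) ∈ L := by
    intro x hx
    obtain ⟨n, hn⟩ := hL.inner_int he hx
    rw [hπ, hn, Int.cast_smul_eq_zsmul]
    exact L.sub_mem hx (L.smul_mem n he)
  have hperp : ∀ x : (ℝ ∙ e)ᗮ, inner ℝ e (x : E) = 0 := fun x =>
    Submodule.mem_orthogonal_singleton_iff_inner_right.1 x.2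
  have hπx : ∀ x : (ℝ ∙ e)ᗮ, π x = x := fun x => Subtype.ext <| by
    rw [hπ, hperp, zero_smul, sub_zero]
  refine ⟨?_, fun x => ⟨fun hx y hy => hL.inner_int hx hy, fun hx => ?_⟩⟩
  · have h1 : Submodule.map π (Submodule.span ℝ (L : Set E)) = ⊤ := by
      rw [hL.span_eq_top, Submodule.map_top, LinearMap.range_eq_top]
      exact fun x => ⟨x, hπx x⟩
    rw [eq_top_iff, ← h1, Submodule.map_span, Submodule.span_le]
    rintro _ ⟨x, hx, rfl⟩
    exact Submodule.subset_span (hπL x hx)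
  · refine (hL.mem_iff _).2 fun y hy => ?_
    obtain ⟨n, hn⟩ := hx (π y) (hπL y hy)
    refine ⟨n, ?_⟩
    rw [← hn, Submodule.coe_inner, hπ, inner_sub_right, real_inner_smul_right, real_inner_comm e,
      hperp, mul_zero, sub_zero]
    rfl

theorem exists_norm_sq_sum_sign_eq_sq [FiniteDimensional ℝ E] (hL : IsUnimodular L)
    (hE : finrank ℝ E = 25) {e' : E} (he : e ∈ L) (he1 : ‖e‖ = 1) (he' : e' ∈ L) (he1' : ‖e'‖ = 1)
    (hee : inner ℝ e e' = 0) (hR : ∀ x, x ∈ R ↔ x ∈ L ∧ ‖x‖ ^ 2 = 2) (hs : IsRootSign R s) :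
    ∃ k : ℤ, ‖∑ r ∈ R, s r • r‖ ^ 2 = 16 * (k : ℝ) ^ 2 := by
  have hL' := hL.orthogonal he he1
  set L' := L.comap ((Submodule.subtype (ℝ ∙ e)ᗮ).restrictScalars ℤ)
  have hmem : ∀ x : (ℝ ∙ e)ᗮ, x ∈ L' ↔ (x : E) ∈ L := fun x => Iff.rfl
  have hE' : finrank ℝ (ℝ ∙ e)ᗮ = 24 := by
    have h1 := (ℝ ∙ e).finrank_add_finrank_orthogonal
    rw [finrank_span_singleton (norm_ne_zero_iff.1 (by rw [he1]; norm_num)), hE] at h1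
    omega
  let R' := (hL'.finite_norm_eq 2).toFinset
  let U' := (hL'.finite_norm_eq 1).toFinset
  have hR' : ∀ x, x ∈ R' ↔ x ∈ L' ∧ ‖x‖ ^ 2 = 2 := fun x => by simp [R']
  have hU' : ∀ x, x ∈ U' ↔ x ∈ L' ∧ ‖x‖ ^ 2 = 1 := fun x => by simp [U']
  have hmap : ∀ (W : Finset (ℝ ∙ e)ᗮ) (r : ℝ), (∀ x, x ∈ W ↔ x ∈ L' ∧ ‖x‖ ^ 2 = r) →
      ∀ x, x ∈ W.map (Function.Embedding.subtype _) ↔ x ∈ L ∧ ‖x‖ ^ 2 = r ∧ inner ℝ e x = 0 := by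
    intro W r hW x
    rw [Finset.mem_map]
    constructor
    · rintro ⟨y, hy, rfl⟩
      exact ⟨((hW y).1 hy).1, ((hW y).1 hy).2,
        Submodule.mem_orthogonal_singleton_iff_inner_right.1 y.2⟩
    · rintro ⟨h1, h2, h3⟩
      exact ⟨⟨x, Submodule.mem_orthogonal_singleton_iff_inner_right.2 h3⟩, (hW _).2 ⟨h1, h2⟩, rfl⟩
  have hR'R : ∀ x ∈ R', (x : E) ∈ R := fun x hx => (hR _).2 ((hR' x).1 hx)
  obtain ⟨h, k, hk, hT⟩ := hL'.exists_norm_sq_sum_sign hE' (e := ⟨e',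
    Submodule.mem_orthogonal_singleton_iff_inner_right.2 hee⟩) he' he1' hR' hU'
    (s := fun x : (ℝ ∙ e)ᗮ => s x) ⟨fun a ha => hs.eq_or _ (hR'R a ha),
      fun a ha => hs.neg _ (hR'R a ha),
      fun a ha b hb hab => hs.add _ (hR'R a ha) _ (hR'R b hb) (hR'R _ hab)⟩
  refine ⟨h + k + 1, ?_⟩
  rw [hL.norm_sq_sum_sign_eq_add he he1 hR (hmap R' 2 hR') (hmap U' 1 hU') hs, Finset.card_map, hk,
    Finset.sum_map]
  have h1 : ‖∑ r ∈ R', s (r : E) • (r : E)‖ ^ 2 = ‖∑ r ∈ R', s (r : E) • r‖ ^ 2 := by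
    rw [Submodule.coe_norm]
    simp
  simp only [Function.Embedding.subtype_apply]
  rw [h1, hT]
  push_cast
  ring

end IsUnimodular

end Layers

section Transport

open Module

variable {V : Type*} [AddCommGroup V] [Module ℚ V]

theorem exists_zsmul_mem_of_span_eq_top {A : Submodule ℤ V}
    (hspan : Submodule.span ℚ (A : Set V) = ⊤) (x : V) : ∃ n : ℤ, n ≠ 0 ∧ n • x ∈ A := by
  have hx : x ∈ Submodule.span ℚ (A : Set V) := by rw [hspan]; trivial
  induction hx using Submodule.span_induction with
  | mem x hx => exact ⟨1, one_ne_zero, by simpa using hx⟩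
  | zero => exact ⟨1, one_ne_zero, by simp⟩
  | add x y _ _ hx hy =>
    obtain ⟨n, hn, hx⟩ := hx
    obtain ⟨m, hm, hy⟩ := hy
    refine ⟨n * m, mul_ne_zero hn hm, ?_⟩
    rw [smul_add, mul_comm n, mul_smul, mul_comm m, mul_smul]
    exact A.add_mem (A.smul_mem _ hx) (A.smul_mem _ hy)
  | smul q x _ hx =>
    obtain ⟨n, hn, hx⟩ := hx
    refine ⟨q.den * n, mul_ne_zero (by exact_mod_cast q.den_ne_zero) hn, ?_⟩
    have h1 : ((q.den : ℤ) * n) • q • x = q.num • n • x := by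
      simp only [← Int.cast_smul_eq_zsmul ℚ, smul_smul]
      congr 1
      push_cast
      linear_combination (n : ℚ) * Rat.den_mul_eq_num q
    rw [h1]
    exact A.smul_mem _ hx

theorem exists_euclidean_embedding [FiniteDimensional ℚ V] (B : V →ₗ[ℚ] V →ₗ[ℚ] ℚ)
    (hsymm : ∀ x y, B x y = B y x) (hpos : ∀ x, x ≠ 0 → 0 < B x x) :
    ∃ φ : V →+ EuclideanSpace ℝ (Fin (finrank ℚ V)),
      (∀ x y, inner ℝ (φ x) (φ y) = (B x y : ℝ)) ∧
      Submodule.span ℝ (Set.range φ) = ⊤ ∧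
      (∀ f : V →ₗ[ℚ] ℚ, ∃ g : EuclideanSpace ℝ (Fin (finrank ℚ V)) →ₗ[ℝ] ℝ,
        ∀ x, g (φ x) = f x) ∧
      ∀ z, (∀ y, ∃ p : ℚ, inner ℝ z (φ y) = p) → ∃ x, φ x = z := by
  obtain ⟨v, hv⟩ := LinearMap.BilinForm.exists_orthogonal_basis (B := B) ⟨hsymm⟩
  have hq : ∀ i, (0 : ℝ) < B (v i) (v i) := fun i => by exact_mod_cast hpos _ (v.ne_zero i)
  let q : Fin (finrank ℚ V) → ℝ := fun i => √(B (v i) (v i) : ℝ)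
  have hq0 : ∀ i, q i ≠ 0 := fun i => (Real.sqrt_pos.2 (hq i)).ne'
  have hqq : ∀ i, q i * q i = B (v i) (v i) := fun i => Real.mul_self_sqrt (hq i).le
  have hB : ∀ x y, B x y = ∑ i, v.repr x i * v.repr y i * B (v i) (v i) := by
    intro x y
    conv_lhs => rw [← v.sum_repr x, ← v.sum_repr y]
    simp only [map_sum, map_smul, LinearMap.sum_apply, LinearMap.smul_apply, smul_eq_mul]
    refine Finset.sum_congr rfl fun i _ => ?_
    rw [Finset.sum_eq_single i]
    · ring
    · intro j _ hj
      have h1 : B (v j) (v i) = 0 := hv hj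
      simp [h1]
    · simp
  let φ : V →+ EuclideanSpace ℝ (Fin (finrank ℚ V)) :=
    { toFun := fun x => WithLp.toLp 2 fun i => q i * v.repr x i
      map_zero' := by ext i; simp
      map_add' := fun x y => by ext i; simp [mul_add] }
  have hφ : ∀ x i, φ x i = q i * v.repr x i := fun x i => rfl
  have hφv : ∀ z i, inner ℝ z (φ (v i)) = z i * q i := by
    intro z i
    rw [PiLp.inner_apply, Finset.sum_eq_single i]
    · simp [hφ, mul_comm]
    · intro j _ hj
      simp [hφ, hj]
    · simp
  refine ⟨φ, fun x y => ?_, ?_, fun f => ?_, fun z hz => ?_⟩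
  · rw [PiLp.inner_apply, hB]
    push_cast
    refine Finset.sum_congr rfl fun i _ => ?_
    simp only [hφ, RCLike.inner_apply, conj_trivial]
    rw [← hqq]
    ring
  · rw [← Submodule.orthogonal_eq_bot_iff, Submodule.eq_bot_iff]
    intro z hz
    ext i
    have h1 := (Submodule.mem_orthogonal' _ z).1 hz _ (Submodule.subset_span ⟨v i, rfl⟩)
    rw [hφv] at h1
    simpa [hq0 i] using h1
  · refine ⟨innerₗ _ (WithLp.toLp 2 fun i => f (v i) / q i), fun x => ?_⟩
    conv_rhs => rw [← v.sum_repr x]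
    rw [innerₗ_apply_apply, PiLp.inner_apply, map_sum]
    push_cast
    refine Finset.sum_congr rfl fun i _ => ?_
    simp only [hφ, RCLike.inner_apply, conj_trivial, map_smul, smul_eq_mul]
    push_cast
    field_simp [hq0 i]
  · choose p hp using fun i => hz (v i)
    refine ⟨∑ i, (p i / B (v i) (v i)) • v i, ?_⟩
    ext i
    have h1 := hp i
    rw [hφv] at h1
    rw [hφ, v.repr_sum_self]
    push_cast
    rw [← h1, ← hqq]
    field_simp [hq0 i]

theorem isUnimodular_map {E : Type*} [NormedAddCommGroup E] [InnerProductSpace ℝ E]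
    {A : Submodule ℤ V} {B : V →ₗ[ℚ] V →ₗ[ℚ] ℚ} {φ : V →+ E}
    (hspan : Submodule.span ℚ (A : Set V) = ⊤)
    (hint : ∀ x ∈ A, ∀ y ∈ A, ∃ n : ℤ, B x y = n)
    (hunimod : ∀ v, (∀ y ∈ A, ∃ n : ℤ, B v y = n) → v ∈ A)
    (hφ : ∀ x y, inner ℝ (φ x) (φ y) = (B x y : ℝ))
    (hφspan : Submodule.span ℝ (Set.range φ) = ⊤)
    (hφrat : ∀ z, (∀ y, ∃ p : ℚ, inner ℝ z (φ y) = p) → ∃ x, φ x = z) :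
    IsUnimodular (A.map φ.toIntLinearMap) := by
  refine ⟨?_, fun x => ⟨?_, fun hx => ?_⟩⟩
  · rw [eq_top_iff, ← hφspan, Submodule.span_le]
    rintro _ ⟨x, rfl⟩
    obtain ⟨n, hn, hx⟩ := exists_zsmul_mem_of_span_eq_top hspan x
    have hn' : (n : ℝ) ≠ 0 := by exact_mod_cast hn
    have h1 : φ x = (n : ℝ)⁻¹ • φ (n • x) := by
      rw [map_zsmul, ← Int.cast_smul_eq_zsmul ℝ, inv_smul_smul₀ hn']
    rw [h1]
    exact Submodule.smul_mem _ _ (Submodule.subset_span ⟨_, hx, rfl⟩)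
  · rintro ⟨a, ha, rfl⟩ _ ⟨b, hb, rfl⟩
    obtain ⟨n, hn⟩ := hint a ha b hb
    refine ⟨n, (hφ a b).trans ?_⟩
    rw [hn]
    push_cast
    rfl
  · obtain ⟨a, rfl⟩ := hφrat x fun y => by
      obtain ⟨n, hn, hy⟩ := exists_zsmul_mem_of_span_eq_top hspan y
      obtain ⟨m, hm⟩ := hx _ ⟨_, hy, rfl⟩
      have hn' : (n : ℝ) ≠ 0 := by exact_mod_cast hn
      have h1 : inner ℝ x (φ (n • y)) = (m : ℝ) := hm
      rw [map_zsmul, ← Int.cast_smul_eq_zsmul ℝ, real_inner_smul_right] at h1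
      refine ⟨m / n, ?_⟩
      push_cast
      rw [← h1]
      field_simp
    refine ⟨a, hunimod a fun y hy => ?_, rfl⟩
    obtain ⟨n, hn⟩ := hx _ ⟨y, hy, rfl⟩
    have h1 : inner ℝ (φ a) (φ y) = (n : ℝ) := hn
    rw [hφ] at h1
    exact ⟨n, by exact_mod_cast h1⟩

theorem exists_orthonormal_pair {A : Submodule ℤ V} {B : V →ₗ[ℚ] V →ₗ[ℚ] ℚ}
    (hsymm : ∀ x y, B x y = B y x) (hint : ∀ x ∈ A, ∀ y ∈ A, ∃ n : ℤ, B x y = n)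
    (hpos : ∀ x, x ≠ 0 → 0 < B x x) (h4 : 4 ≤ {x : V | x ∈ A ∧ B x x = 1}.ncard) :
    ∃ x ∈ A, ∃ y ∈ A, B x x = 1 ∧ B y y = 1 ∧ B x y = 0 := by
  obtain ⟨x, hx, hx1⟩ : {x : V | x ∈ A ∧ B x x = 1}.Nonempty :=
    Set.nonempty_of_ncard_ne_zero (by omega)
  obtain ⟨y, ⟨hy, hy1⟩, hxy⟩ : ∃ y ∈ {x : V | x ∈ A ∧ B x x = 1}, y ∉ ({x, -x} : Set V) := by
    by_contra! h
    have h1 := Set.ncard_le_ncard (show {x : V | x ∈ A ∧ B x x = 1} ⊆ {x, -x} from h)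
    have h2 := Set.ncard_insert_le x {-x}
    rw [Set.ncard_singleton] at h2
    omega
  simp only [Set.mem_insert_iff, Set.mem_singleton_iff, not_or] at hxy
  obtain ⟨n, hn⟩ := hint x hx y hy
  refine ⟨x, hx, y, hy, hx1, hy1, ?_⟩
  have h1 := hpos (x - y) (sub_ne_zero.2 (Ne.symm hxy.1))
  have h2 := hpos (x + y) fun h => hxy.2 (eq_neg_of_add_eq_zero_right h)
  simp only [map_sub, map_add, LinearMap.sub_apply, LinearMap.add_apply, hsymm y x, hx1, hy1,
    hn] at h1 h2
  have h3 : n < 1 := by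
    have : (n : ℚ) < 1 := by linarith
    exact_mod_cast this
  have h4 : -1 < n := by
    have : (-1 : ℚ) < n := by linarith
    exact_mod_cast this
  rw [hn, show n = 0 by omega, Int.cast_zero]

theorem sum_lexSign_zero_smul {E : Type*} [NormedAddCommGroup E] [InnerProductSpace ℝ E]
    {R : Finset E} (hR : IsRootSet R) {g : E →ₗ[ℝ] ℝ} (hg : ∀ r ∈ R, g r ≠ 0) :
    ∑ r ∈ R, lexSign g 0 r • r = (2 : ℝ) • ∑ r ∈ R with 0 < g r, r := by
  have h1 := hR.sum_neg (fun r => 0 < g r) fun r => -r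
  simp only [neg_neg, map_neg, Left.neg_pos_iff] at h1
  rw [two_smul]
  nth_rewrite 2 [← h1]
  simp only [Finset.sum_filter, ← Finset.sum_add_distrib]
  refine Finset.sum_congr rfl fun r hr => ?_
  rcases lt_or_gt_of_ne (hg r hr) with h | h <;> simp [lexSign, h, h.ne, h.ne', h.not_gt]

end Transport

/-- If `A` is a positive definite unimodular lattice of rank 25 with at least 4 vectors of
norm 1 (i.e. `A ≅ L ⊕ I^{25−n}` with `dim L ≤ 23`), then the norm of the Weyl vector of `A`
is the square of an integer. -/
theorem unimodular25_weyl_norm_is_square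
    (V : Type*) [AddCommGroup V] [Module ℚ V]
    (A : Submodule ℤ V) (hfg : A.FG)
    (hspan : Submodule.span ℚ (A : Set V) = ⊤)
    (hrank : Module.finrank ℚ V = 25)
    (B : V →ₗ[ℚ] V →ₗ[ℚ] ℚ)
    (hsymm : ∀ x y : V, B x y = B y x)
    (hint : ∀ x ∈ A, ∀ y ∈ A, ∃ n : ℤ, B x y = (n : ℚ))
    (hpos : ∀ x ∈ A, x ≠ 0 → 0 < B x x)
    (hunimod : ∀ v : V, (∀ y ∈ A, ∃ n : ℤ, B v y = (n : ℚ)) → v ∈ A)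
    (h4 : 4 ≤ {x : V | x ∈ A ∧ B x x = 1}.ncard)
    (f : V →ₗ[ℚ] ℚ)
    (hf : ∀ x ∈ A, B x x = 2 → f x ≠ 0)
    (ρ : V)
    (hρ : ρ = (2⁻¹ : ℚ) • ∑ᶠ x ∈ {x : V | x ∈ A ∧ B x x = 2 ∧ 0 < f x}, x) :
    ∃ k : ℤ, B ρ ρ = (k : ℚ) ^ 2 := by
  have : FiniteDimensional ℚ V := Module.finite_of_finrank_pos (by omega)
  have hpos' : ∀ x, x ≠ 0 → 0 < B x x := by
    intro x hx
    obtain ⟨n, hn, hnx⟩ := exists_zsmul_mem_of_span_eq_top hspan x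
    have hn' : (n : ℚ) ≠ 0 := by exact_mod_cast hn
    have h1 := hpos _ hnx (by rw [← Int.cast_smul_eq_zsmul ℚ]; exact smul_ne_zero hn' hx)
    rw [← Int.cast_smul_eq_zsmul ℚ, map_smul, map_smul, LinearMap.smul_apply, smul_smul,
      smul_eq_mul] at h1
    exact pos_of_mul_pos_right h1 (mul_self_nonneg _)
  obtain ⟨φ, hφ, hφspan, hφf, hφrat⟩ := exists_euclidean_embedding B hsymm hpos'
  obtain ⟨g, hg⟩ := hφf f
  have hL := isUnimodular_map hspan hint hunimod hφ hφspan hφrat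
  have hφsq : ∀ x, ‖φ x‖ ^ 2 = (B x x : ℝ) := fun x => by rw [← real_inner_self_eq_norm_sq, hφ]
  have hφinj : Function.Injective φ := by
    refine (injective_iff_map_eq_zero φ).2 fun x hx => ?_
    by_contra h
    have h1 := hφsq x
    rw [hx, norm_zero] at h1
    have h2 : (0 : ℝ) < B x x := by exact_mod_cast hpos' x h
    simp at h1
    linarith
  let R := (hL.finite_norm_eq 2).toFinset
  have hR : ∀ x, x ∈ R ↔ x ∈ A.map φ.toIntLinearMap ∧ ‖x‖ ^ 2 = 2 := fun x => by simp [R]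
  have hRφ : ∀ r ∈ R, ∃ x ∈ A, B x x = 2 ∧ φ x = r := by
    intro r hr
    obtain ⟨⟨x, hx, rfl⟩, hr⟩ := (hR r).1 hr
    refine ⟨x, hx, ?_, rfl⟩
    have h1 := hφsq x
    rw [show ‖φ x‖ ^ 2 = 2 from hr] at h1
    exact_mod_cast h1.symm
  have hφR : ∀ x ∈ A, B x x = 2 → φ x ∈ R := fun x hx h =>
    (hR _).2 ⟨⟨x, hx, rfl⟩, by rw [hφsq, h]; norm_num⟩
  have hgR : ∀ r ∈ R, g r ≠ 0 := by
    intro r hr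
    obtain ⟨x, hx, h, rfl⟩ := hRφ r hr
    rw [hg]
    exact_mod_cast hf x hx h
  have hs : IsRootSign R (lexSign g 0) := by
    refine isRootSign_lexSign ?_
    rw [Finset.filter_false_of_mem hgR]
    exact ⟨by simp, by simp, by simp⟩
  have hφρ : ∑ r ∈ R, lexSign g 0 r • r = (4 : ℝ) • φ ρ := by
    have hS : {x : V | x ∈ A ∧ B x x = 2 ∧ 0 < f x}.Finite :=
      Set.Finite.of_finite_image (R.finite_toSet.subset (by
        rintro _ ⟨x, ⟨hx, h, -⟩, rfl⟩
        exact hφR x hx h)) hφinj.injOn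
    have h1 : ∑ r ∈ R with 0 < g r, r = (2 : ℝ) • φ ρ := by
      have h2 : (2 : ℝ) • φ ρ = φ ((2 : ℚ) • ρ) := by
        rw [two_smul, two_smul, map_add]
      rw [h2, hρ, smul_smul, mul_inv_cancel₀ two_ne_zero, one_smul,
        finsum_mem_eq_finite_toFinset_sum _ hS, map_sum]
      symm
      refine Finset.sum_nbij φ (fun x hx => ?_) hφinj.injOn (fun r hr => ?_) fun _ _ => rfl
      · obtain ⟨hx, h, h0⟩ := hS.mem_toFinset.1 hx
        exact Finset.mem_filter.2 ⟨hφR x hx h, by rw [hg]; exact_mod_cast h0⟩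
      · obtain ⟨hr, h0⟩ := Finset.mem_filter.1 hr
        obtain ⟨x, hx, h, rfl⟩ := hRφ r hr
        rw [hg] at h0
        exact ⟨x, hS.mem_toFinset.2 ⟨hx, h, by exact_mod_cast h0⟩, rfl⟩
    rw [sum_lexSign_zero_smul (hL.isRootSet hR) hgR, h1, smul_smul]
    norm_num
  obtain ⟨x, hx, y, hy, hx1, hy1, hxy⟩ := exists_orthonormal_pair hsymm hint hpos' h4
  have hunit : ∀ z, B z z = 1 → ‖φ z‖ = 1 := fun z hz => by
    have h1 := hφsq z
    rw [hz, Rat.cast_one] at h1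
    exact (pow_eq_one_iff_of_nonneg (norm_nonneg _) two_ne_zero).1 h1
  obtain ⟨k, hk⟩ := hL.exists_norm_sq_sum_sign_eq_sq (by rw [finrank_euclideanSpace_fin, hrank])
    ⟨x, hx, rfl⟩ (hunit x hx1) ⟨y, hy, rfl⟩ (hunit y hy1)
    ((hφ x y).trans (by rw [hxy, Rat.cast_zero])) hR hs
  refine ⟨k, ?_⟩
  rw [hφρ, norm_smul, mul_pow, hφsq] at hk
  have h1 : (B ρ ρ : ℝ) = (k : ℝ) ^ 2 := by
    norm_num at hk
    linarith
  exact_mod_cast h1
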